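/- arXiv:1605.06701 — 6 statements merged into one kernel-verified Lean document; each statement's English description precedes it below -/
import Mathlib

section
/- Let G be a nonempty finite simple graph, let p be a prime with p ≤ ω(G) (i.e., G contains a complete subgraph on p vertices), and set t = Xind_{Z_p}(Hom(K_p, G)) + p. Then the local chromatic number of G satisfies χ_l(G) ≥ t − ⌊t/p⌋ + 1. -/
/-- Elements of the `Z_p`-hom-complex `Hom(K_p, G)` of a graph `G`: `p`-tuples of
nonempty pairwise disjoint vertex subsets with all cross pairs adjacent. -/
def HomElemG {V : Type*} [DecidableEq V] (G : SimpleGraph V) (p : ℕ)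
    (U : ZMod p → Finset V) : Prop :=
  (∀ i, (U i).Nonempty) ∧ (∀ i j, i ≠ j → Disjoint (U i) (U j)) ∧
    (∀ i j, i ≠ j → ∀ u ∈ U i, ∀ v ∈ U j, G.Adj u v)

/-- The cross-index `Xind_{Z_p}(Hom(K_p, G))`: the least `n` such that there is an
order-preserving `Z_p`-map from `Hom(K_p, G)` (ordered by componentwise inclusion,
with `Z_p` acting by cyclic shift) to `Q_{n,p}`. -/
noncomputable def XindG {V : Type*} [DecidableEq V] (G : SimpleGraph V) (p : ℕ) : ℕ :=
  sInf {n | ∃ φ : (ZMod p → Finset V) → ZMod p × Fin (n + 1),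
    (∀ x y, HomElemG G p x → HomElemG G p y → (∀ i, x i ⊆ y i) →
      ((φ x).2 < (φ y).2 ∨ φ x = φ y)) ∧
    (∀ (ε : ZMod p) (x), HomElemG G p x →
      φ (fun i => x (i + ε)) = (ε + (φ x).1, (φ x).2))}

namespace LCG

variable {p : ℕ} [Fact p.Prime]

noncomputable def hm (a : ZMod p → ℕ) : ℕ := Finset.univ.inf' Finset.univ_nonempty a

noncomputable def J (a : ZMod p → ℕ) : Finset (ZMod p) := Finset.univ.filter (fun j => hm a < a j)

noncomputable def lev (a : ZMod p → ℕ) : ℕ := p * hm a + (J a).card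

lemma hm_le (a : ZMod p → ℕ) (j) : hm a ≤ a j := Finset.inf'_le _ (Finset.mem_univ j)

lemma hm_ex (a : ZMod p → ℕ) : ∃ j, a j = hm a := by
  obtain ⟨j, _, h⟩ := Finset.exists_mem_eq_inf' (Finset.univ_nonempty (α := ZMod p)) a
  exact ⟨j, h.symm⟩

lemma le_hm (a : ZMod p → ℕ) (n : ℕ) (h : ∀ j, n ≤ a j) : n ≤ hm a := by
  obtain ⟨j, hj⟩ := hm_ex a
  exact hj ▸ h j

lemma mem_J (a : ZMod p → ℕ) (j) : j ∈ J a ↔ hm a < a j := by simp [J]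

lemma J_card (a : ZMod p → ℕ) : (J a).card < p := by
  obtain ⟨j, hj⟩ := hm_ex a
  have : (J a).card < (Finset.univ : Finset (ZMod p)).card := by
    apply Finset.card_lt_card
    refine Finset.ssubset_univ_iff.2 fun h => ?_
    have : j ∈ J a := h ▸ Finset.mem_univ j
    rw [mem_J] at this; omega
  rwa [Finset.card_univ, ZMod.card] at this

lemma hm_mono {a b : ZMod p → ℕ} (h : ∀ j, a j ≤ b j) : hm a ≤ hm b :=
  le_hm _ _ fun j => (hm_le a j).trans (h j)

lemma lev_lt {a b : ZMod p → ℕ} (h : hm a < hm b) : lev a < lev b := by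
  have h1 := J_card a
  have h2 : p * (hm a + 1) ≤ p * hm b := Nat.mul_le_mul_left p h
  unfold lev
  rw [mul_add] at h2
  omega

lemma lev_mono {a b : ZMod p → ℕ} (h : ∀ j, a j ≤ b j) :
    lev a < lev b ∨ (lev a = lev b ∧ hm a = hm b ∧ J a = J b) := by
  rcases (hm_mono h).lt_or_eq with h1 | h1
  · exact Or.inl (lev_lt h1)
  · have hs : J a ⊆ J b := by
      intro j hj
      rw [mem_J] at *
      have := h j; omega
    by_cases hJ : J a = J b
    · right; exact ⟨by simp [lev, h1, hJ], h1, hJ⟩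
    · left
      have := Finset.card_lt_card (Finset.ssubset_iff_subset_ne.2 ⟨hs, hJ⟩)
      unfold lev; rw [h1]; omega

lemma hm_shift (a : ZMod p → ℕ) (e : ZMod p) : hm (fun i => a (i + e)) = hm a := by
  apply le_antisymm
  · refine le_hm _ _ fun j => ?_
    simpa using hm_le (fun i => a (i + e)) (j - e)
  · exact le_hm _ _ fun j => hm_le a _

lemma J_shift (a : ZMod p → ℕ) (e : ZMod p) :
    J (fun i => a (i + e)) = (J a).map (Equiv.subRight e).toEmbedding := by
  ext j
  rw [Finset.mem_map_equiv, mem_J, mem_J, hm_shift]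
  simp

lemma J_shift_card (a : ZMod p → ℕ) (e : ZMod p) :
    (J (fun i => a (i + e))).card = (J a).card := by
  rw [J_shift, Finset.card_map]

variable {C : Type*} [DecidableEq C]

noncomputable def pick (f : Finset C → C) (A : ZMod p → Finset C) : ZMod p :=
  Classical.epsilon (fun j => f (Finset.univ.biUnion A) ∈ A j)

lemma pick_spec (f : Finset C → C) (hf : ∀ S : Finset C, S.Nonempty → f S ∈ S)
    (A : ZMod p → Finset C) (hA : ∀ i, (A i).Nonempty) :
    f (Finset.univ.biUnion A) ∈ A (pick f A) := by
  have h : f (Finset.univ.biUnion A) ∈ Finset.univ.biUnion A := by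
    apply hf
    obtain ⟨x, hx⟩ := hA 0
    exact ⟨x, Finset.mem_biUnion.2 ⟨0, Finset.mem_univ _, hx⟩⟩
  obtain ⟨j, _, hj⟩ := Finset.mem_biUnion.1 h
  exact Classical.epsilon_spec (p := fun j => f (Finset.univ.biUnion A) ∈ A j) ⟨j, hj⟩

lemma pick_shift (f : Finset C → C) (hf : ∀ S : Finset C, S.Nonempty → f S ∈ S)
    (A : ZMod p → Finset C) (hA : ∀ i, (A i).Nonempty)
    (hd : ∀ i j, i ≠ j → Disjoint (A i) (A j)) (e : ZMod p) :
    pick f (fun i => A (i + e)) + e = pick f A := by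
  by_contra hne
  have h1 := pick_spec f hf A hA
  have h2 := pick_spec f hf (fun i => A (i + e)) (fun i => hA _)
  have h3 : Finset.univ.biUnion (fun i => A (i + e)) = Finset.univ.biUnion A := by
    ext x
    simp only [Finset.mem_biUnion, Finset.mem_univ, true_and]
    constructor
    · rintro ⟨i, hi⟩; exact ⟨_, hi⟩
    · rintro ⟨i, hi⟩; exact ⟨i - e, by simpa using hi⟩
  rw [h3] at h2
  exact Finset.disjoint_left.1 (hd _ _ hne) h2 h1

noncomputable def sgn (f : Finset C → C) (A : ZMod p → Finset C) : ZMod p :=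
  if J (fun i => (A i).card) = ∅ then - pick f A
  else - (∑ j ∈ J (fun i => (A i).card), j) / ((J (fun i => (A i).card)).card : ZMod p)

lemma sgn_shift (f : Finset C → C) (hf : ∀ S : Finset C, S.Nonempty → f S ∈ S)
    (A : ZMod p → Finset C) (hA : ∀ i, (A i).Nonempty)
    (hd : ∀ i j, i ≠ j → Disjoint (A i) (A j)) (e : ZMod p) :
    sgn f (fun i => A (i + e)) = e + sgn f A := by
  have hJ := J_shift (fun i => (A i).card) e
  have hcard := J_card (fun i => (A i).card)
  unfold sgn
  rw [hJ]
  by_cases h0 : J (fun i => (A i).card) = ∅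
  · rw [if_pos (by rw [h0]; simp), if_pos h0, ← pick_shift f hf A hA hd e]
    ring
  · rw [if_neg (by simpa using h0), if_neg h0]
    have hn : ((J (fun i => (A i).card)).card : ZMod p) ≠ 0 := by
      rw [Ne, ZMod.natCast_eq_zero_iff]
      intro hdv
      have := Nat.le_of_dvd (Finset.card_pos.2 (Finset.nonempty_iff_ne_empty.2 h0)) hdv
      omega
    rw [Finset.card_map, Finset.sum_map]
    simp only [Equiv.coe_toEmbedding, Equiv.subRight_apply, Finset.sum_sub_distrib,
      Finset.sum_const, nsmul_eq_mul]
    field_simp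
    ring

lemma sgn_mono (f : Finset C → C) (A B : ZMod p → Finset C) (hAB : ∀ i, A i ⊆ B i) :
    lev (fun i => (A i).card) < lev (fun i => (B i).card) ∨
    (lev (fun i => (A i).card) = lev (fun i => (B i).card) ∧ sgn f A = sgn f B) := by
  rcases lev_mono (a := fun i => (A i).card) (b := fun i => (B i).card)
    (fun j => Finset.card_le_card (hAB j)) with h | ⟨h1, h2, h3⟩
  · exact Or.inl h
  · right
    refine ⟨h1, ?_⟩
    by_cases h0 : J (fun i => (B i).card) = ∅
    · have : A = B := by
        funext i
        apply Finset.eq_of_subset_of_card_le (hAB i)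
        have hb : i ∉ J (fun i => (B i).card) := by rw [h0]; simp
        rw [mem_J] at hb
        have := hm_le (fun i => (A i).card) i
        try beta_reduce at *
        omega
      rw [this]
    · unfold sgn
      rw [h3, if_neg h0, if_neg h0]

end LCG

theorem local_chromatic_graph {V : Type*} [Fintype V] [DecidableEq V]
    (G : SimpleGraph V) (hG : ∃ u v, G.Adj u v)
    (p : ℕ) (hp : p.Prime) (hω : ∃ S : Finset V, G.IsNClique p S)
    (Ct : Type*) (c : V → Ct) (hc : ∀ u v, G.Adj u v → c u ≠ c v) :
    ∃ v : V,
      XindG G p + p - (XindG G p + p) / p + 1 ≤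
        (c '' (insert v (G.neighborSet v))).ncard := by
  classical
  haveI : Fact p.Prime := ⟨hp⟩
  obtain ⟨u0, _, _⟩ := hG
  have hcf : ∃ f : Finset Ct → Ct, ∀ S : Finset Ct, S.Nonempty → f S ∈ S :=
    ⟨fun S => if h : S.Nonempty then h.choose else c u0, fun S h => by
      simp only [dif_pos h]; exact h.choose_spec⟩
  obtain ⟨f, hf⟩ := hcf
  let A : (ZMod p → Finset V) → ZMod p → Finset Ct := fun x i => (x i).image c
  let l : (ZMod p → Finset V) → ℕ := fun x => LCG.lev (fun i => (A x i).card)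
  have hAne : ∀ x, HomElemG G p x → ∀ i, (A x i).Nonempty := fun x hx i => (hx.1 i).image c
  have hAd : ∀ x, HomElemG G p x → ∀ i j, i ≠ j → Disjoint (A x i) (A x j) := by
    intro x hx i j hij
    rw [Finset.disjoint_left]
    intro a ha hb
    obtain ⟨u, hu, rfl⟩ := Finset.mem_image.1 ha
    obtain ⟨v, hv, huv⟩ := Finset.mem_image.1 hb
    exact hc u v (hx.2.2 i j hij u hu v hv) huv.symm
  have hlp : ∀ x, HomElemG G p x → p ≤ l x := by
    intro x hx
    have : 1 ≤ LCG.hm (fun i => (A x i).card) :=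
      LCG.le_hm _ _ fun j => Finset.card_pos.2 (hAne x hx j)
    have := Nat.mul_le_mul_left p this
    simp only [l, LCG.lev]; omega
  have hex : ∃ x, HomElemG G p x := by
    obtain ⟨S, hS⟩ := hω
    have e : ZMod p ≃ S := Fintype.equivOfCardEq (by rw [ZMod.card, Fintype.card_coe, hS.card_eq])
    have hne : ∀ i j, i ≠ j → (e i : V) ≠ e j := fun i j hij h => hij (e.injective (Subtype.ext h))
    refine ⟨fun i => {(e i : V)}, fun i => Finset.singleton_nonempty _, ?_, ?_⟩
    · intro i j hij
      simpa using hne i j hij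
    · intro i j hij u hu v hv
      rw [Finset.mem_singleton] at hu hv
      subst hu hv
      exact hS.isClique (e i).2 (e j).2 (hne i j hij)
  have key : ∃ x, HomElemG G p x ∧ XindG G p + p ≤ l x := by
    by_contra hno
    push Not at hno
    rcases hK : XindG G p with _ | n
    · obtain ⟨x, hx⟩ := hex
      have h1 := hno x hx
      have h2 := hlp x hx
      omega
    · have hle : XindG G p ≤ n := by
        apply Nat.sInf_le
        refine ⟨fun x => (LCG.sgn f (A x), Fin.ofNat (n + 1) (l x - p)), ?_, ?_⟩
        · intro x y hx hy hxy
          have h1 := hno x hx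
          have h2 := hno y hy
          have h3 := hlp x hx
          have h4 := hlp y hy
          rcases LCG.sgn_mono f (A x) (A y) (fun i => Finset.image_subset_image (hxy i)) with h | ⟨h, h'⟩
          · left
            change l x < l y at h
            rw [Fin.lt_def]
            simp only [Fin.ofNat]
            rw [Nat.mod_eq_of_lt (by omega), Nat.mod_eq_of_lt (by omega)]
            omega
          · right
            change l x = l y at h
            simp only [h, h']
        · intro e x hx
          have h1 := LCG.sgn_shift f hf (A x) (hAne x hx) (hAd x hx) e
          have h2 : l (fun i => x (i + e)) = l x := by
            simp only [l, LCG.lev]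
            have ha := LCG.hm_shift (fun i => (A x i).card) e
            have hb := LCG.J_shift_card (fun i => (A x i).card) e
            exact congrArg₂ (fun a b => p * a + b) ha hb
          simp only [h2]
          exact Prod.ext h1 rfl
      omega
  obtain ⟨x, hx, hl⟩ := key
  obtain ⟨j0, hj0⟩ := LCG.hm_ex (fun i => (A x i).card)
  obtain ⟨v, hv⟩ := hx.1 j0
  refine ⟨v, ?_⟩
  set h := LCG.hm (fun i => (A x i).card) with hh
  have hJc := LCG.J_card (fun i => (A x i).card)
  set T := Finset.univ.erase j0 with hT
  have hsub : ((insert (c v) (T.biUnion (A x)) : Finset Ct) : Set Ct) ⊆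
      c '' (insert v (G.neighborSet v)) := by
    intro y hy
    rw [Finset.mem_coe, Finset.mem_insert, Finset.mem_biUnion] at hy
    rcases hy with rfl | ⟨j, hj, hy⟩
    · exact ⟨v, Set.mem_insert _ _, rfl⟩
    · obtain ⟨u, hu, rfl⟩ := Finset.mem_image.1 hy
      exact ⟨u, Set.mem_insert_of_mem _ (hx.2.2 j0 j (Finset.ne_of_mem_erase hj).symm v hv u hu), rfl⟩
  have hcard := Set.ncard_le_ncard hsub (Set.toFinite _)
  rw [Set.ncard_coe_finset, Finset.card_insert_of_notMem, Finset.card_biUnion] at hcard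
  · have hsum : (p - 1) * h + (LCG.J (fun i => (A x i).card)).card ≤ ∑ j ∈ T, (A x j).card := by
      have hTc : T.card = p - 1 := by
        rw [hT, Finset.card_erase_of_mem (Finset.mem_univ _), Finset.card_univ, ZMod.card]
      have hJT : LCG.J (fun i => (A x i).card) = T.filter (fun j => h < (A x j).card) := by
        ext j
        rw [LCG.mem_J, Finset.mem_filter, hT, Finset.mem_erase]
        constructor
        · intro hj
          refine ⟨⟨?_, Finset.mem_univ _⟩, hj⟩
          rintro rfl
          try beta_reduce at hj0 hj
          omega
        · exact fun hj => hj.2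
      rw [hJT, Finset.card_filter, ← hTc, ← smul_eq_mul, ← Finset.sum_const, ← Finset.sum_add_distrib]
      apply Finset.sum_le_sum
      intro j _
      have := LCG.hm_le (fun i => (A x i).card) j
      try beta_reduce at this
      split_ifs <;> omega
    have hl' : XindG G p + p ≤ p * h + (LCG.J (fun i => (A x i).card)).card := hl
    set q := (LCG.J (fun i => (A x i).card)).card
    set t := XindG G p + p
    have hp0 := hp.pos
    have hmain : t - t / p ≤ (p - 1) * h + q := by
      have hpm' : ∀ k, p * k = (p - 1) * k + k := by
        intro k
        conv_lhs => rw [← Nat.sub_add_cancel hp.one_le]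
        ring
      have hpm := hpm' h
      by_cases ht : h ≤ t / p
      · omega
      · have h1 := Nat.div_add_mod t p
        have h2 := Nat.mod_lt t hp0
        obtain ⟨d, hd⟩ : ∃ d, h = t / p + 1 + d := ⟨h - t / p - 1, by omega⟩
        have h3 : p * (t / p) = (p - 1) * (t / p) + t / p := hpm' _
        have h4 : (p - 1) * (t / p + 1) ≤ (p - 1) * h := Nat.mul_le_mul_left _ (by omega)
        rw [mul_add] at h4
        omega
    omega
  · intro i _ j _ hij
    exact hAd x hx i j hij
  · rw [Finset.mem_biUnion]
    rintro ⟨j, hj, hy⟩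
    exact Finset.disjoint_left.1 (hAd x hx j j0 (Finset.ne_of_mem_erase hj)) hy
      (Finset.mem_image_of_mem c hv)
end

section
/- Let k ≥ 2 be an integer, p a prime, and n an integer with n ≥ pk. Then the local chromatic number of the Kneser graph KG(n,k) satisfies χ_l(KG(n,k)) ≥ n − p(k−1) − ⌊(n − p(k−1))/p⌋ + 1. -/
namespace LCK
abbrev Lab := ℕ ×ₗ Bool

def lev (x : Lab) : ℕ := (ofLex x).1
def sg (x : Lab) : Bool := (ofLex x).2
def flp (x : Lab) : Lab := toLex (lev x, !sg x)

def alt : Bool → List Lab → ZMod 2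
  | _, [] => 1
  | b, x :: l => if sg x = b then alt (!b) l else 0

lemma le_lev {x y : Lab} (h : x ≤ y) : lev x ≤ lev y := by
  rcases Prod.Lex.le_iff.1 h with h | h
  · exact h.le
  · exact h.1.le

lemma delta_list (l : List Lab) (hl : l.Pairwise (· ≤ ·)) (b : Bool) :
    (l.map (fun x => alt b (l.erase x))).sum = alt b l + alt (!b) l := by
  induction l generalizing b with
  | nil => simp [alt]; decide
  | cons y l ih =>
    have hl' := (List.pairwise_cons.1 hl)
    have e : ∀ x ∈ l, (y :: l).erase x = y :: l.erase x := by
      intro x hx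
      by_cases hxy : y = x
      · subst hxy
        simp only [List.erase_cons_head]
        cases l with
        | nil => simp at hx
        | cons z l =>
          have h1 : y ≤ z := hl'.1 z (by simp)
          have h2 : z ≤ y := by
            rcases List.mem_cons.1 hx with h | h
            · exact h.ge
            · exact (List.pairwise_cons.1 hl'.2).1 y h
          have : y = z := le_antisymm h1 h2
          subst this
          simp
      · rw [List.erase_cons_tail]
        simpa using hxy
    have e2 : (l.map (fun x => alt b ((y :: l).erase x))) =
        l.map (fun x => if sg y = b then alt (!b) (l.erase x) else 0) := by
      apply List.map_congr_left
      intro x hx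
      rw [e x hx, alt]
    rw [List.map_cons, List.sum_cons, e2, List.erase_cons_head]
    have c2 : ∀ z : ZMod 2, z + z = 0 := by decide
    by_cases hy : sg y = b
    · have hy' : ¬ (sg y = !b) := by rw [hy]; cases b <;> simp
      simp only [hy, if_true, ih hl'.2, alt, Bool.not_not]
      have : ¬ (b = !b) := by cases b <;> simp
      simp only [this, if_false, add_zero]
      have := c2 (alt b l)
      linear_combination this
    · have hy' : sg y = !b := by revert hy; cases sg y <;> cases b <;> simp
      have : ¬ ((!b) = b) := by cases b <;> simp
      simp [alt, hy', this]

def F (b : Bool) (M : Multiset Lab) : ZMod 2 := alt b (M.sort (· ≤ ·))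

lemma sort_coe_of (l : List Lab) (hl : l.Pairwise (· ≤ ·)) : (l : Multiset Lab).sort (· ≤ ·) = l := by
  apply List.Perm.eq_of_pairwise (le := (· ≤ ·)) _ (Multiset.pairwise_sort _ _) hl
  · exact Multiset.coe_eq_coe.1 (Multiset.sort_eq _ _)
  · intro a b _ _ h1 h2; exact le_antisymm h1 h2

lemma delta (M : Multiset Lab) (b : Bool) :
    (M.map (fun x => F b (M.erase x))).sum = F b M + F (!b) M := by
  have h := delta_list (M.sort (· ≤ ·)) (Multiset.pairwise_sort _ _) b
  unfold F
  rw [← h]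
  conv_lhs => rw [← Multiset.sort_eq M (· ≤ ·)]
  rw [Multiset.map_coe, Multiset.sum_coe]
  congr 1
  apply List.map_congr_left
  intro x _
  have hb : (instBEqOfDecidableEq : BEq Lab) = instBEqLex (ℕ × Bool) := lawful_beq_subsingleton _ _
  rw [Multiset.coe_erase, hb, sort_coe_of]
  refine List.Pairwise.sublist ?_ (Multiset.pairwise_sort M (· ≤ ·))
  exact List.erase_sublist

lemma alt_flp (b : Bool) (l : List Lab) : alt b (l.map flp) = alt (!b) l := by
  induction l generalizing b with
  | nil => rfl
  | cons x l ih =>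
    simp only [List.map_cons, alt, ih]
    have : (sg (flp x) = b) ↔ (sg x = !b) := by
      simp only [sg, flp, ofLex_toLex]; cases (ofLex x).2 <;> cases b <;> simp
    simp [this]

lemma F_flp (M : Multiset Lab) (h : ∀ x ∈ M, ∀ y ∈ M, lev x = lev y → sg x = sg y) (b : Bool) :
    F b (M.map flp) = F (!b) M := by
  unfold F
  rw [← alt_flp]
  congr 1
  conv_lhs => rw [← Multiset.sort_eq M (· ≤ ·)]
  rw [Multiset.map_coe, sort_coe_of]
  rw [List.pairwise_map]
  refine (Multiset.pairwise_sort M (· ≤ ·)).imp_of_mem ?_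
  intro x y hx hy hxy
  rw [Multiset.mem_sort] at hx hy
  rcases Prod.Lex.le_iff.1 hxy with h1 | h1
  · exact Prod.Lex.le_iff.2 (Or.inl h1)
  · refine Prod.Lex.le_iff.2 (Or.inr ⟨h1.1, ?_⟩)
    have := h x hx y hy h1.1
    simp [flp, this]

section fan
variable {n : ℕ} (lam : Finset (Fin n) → (Fin n → Bool) → Lab)

abbrev Ch (n : ℕ) := Equiv.Perm (Fin n) × (Fin n → Bool)

def T (π : Equiv.Perm (Fin n)) (j : ℕ) : Finset (Fin n) :=
  Finset.univ.filter (fun x => (π.symm x).val < j)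

def L (q : Ch n) (j : ℕ) : Lab := lam (T q.1 (j+1)) q.2

def P (n d : ℕ) : Finset (Ch n) :=
  Finset.univ.filter (fun q => (∀ i : Fin n, d ≤ i.val → q.1 i = i) ∧ (∀ i : Fin n, d ≤ i.val → q.2 i = true))
def Q (n d : ℕ) : Finset (Ch n) :=
  Finset.univ.filter (fun q => (∀ i : Fin n, d+1 ≤ i.val → q.1 i = i) ∧ (∀ i : Fin n, d ≤ i.val → q.2 i = true))

def al (d : ℕ) : ZMod 2 := ∑ q ∈ P n d, F true ((Multiset.range d).map (L lam q))

lemma step_swap (d i : ℕ) (hd : d < n) (hi : i < d) :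
    ∑ q ∈ Q n d, F true (((Multiset.range (d+1)).erase i).map (L lam q)) = 0 := by
  classical
  have c2 : ∀ z : ZMod 2, z + z = 0 := by decide
  set a : Fin n := ⟨i, by omega⟩
  set b : Fin n := ⟨i+1, by omega⟩
  have hab : a ≠ b := by simp [a, b]
  refine Finset.sum_involution (fun q _ => (q.1 * Equiv.swap a b, q.2)) ?_ ?_ ?_ ?_
  · intro q hq
    have : ((Multiset.range (d+1)).erase i).map (L lam (q.1 * Equiv.swap a b, q.2)) =
      ((Multiset.range (d+1)).erase i).map (L lam q) := by
      apply Multiset.map_congr rfl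
      intro j hj
      have hj' : j ≠ i := ((Multiset.nodup_range _).mem_erase_iff.1 hj).1
      unfold L
      congr 1
      ext x
      simp only [T, Finset.mem_filter, Finset.mem_univ, true_and]
      have : (q.1 * Equiv.swap a b).symm x = Equiv.swap a b (q.1.symm x) := rfl
      rw [this, Equiv.swap_apply_def]
      split_ifs with h1 h2
      · rw [h1]; simp [a, b]; omega
      · rw [h2]; simp [a, b]; omega
      · rfl
    rw [this]; exact c2 _
  · intro q hq _ h
    have h1 := congrArg Prod.fst h
    have h2 : Equiv.swap a b = 1 := by simpa using h1
    exact hab (Equiv.swap_eq_one_iff.1 h2)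
  · intro q hq
    simp only [Q, Finset.mem_filter, Finset.mem_univ, true_and] at hq ⊢
    refine ⟨fun j hj => ?_, hq.2⟩
    rw [Equiv.Perm.mul_apply, Equiv.swap_apply_of_ne_of_ne, hq.1 j hj]
    · intro h; rw [h] at hj; simp [a] at hj; omega
    · intro h; rw [h] at hj; simp [b] at hj; omega
  · intro q hq
    ext : 1 <;> simp [mul_assoc]

lemma step_last (d : ℕ) (hd : d < n)
    (hloc : ∀ T s s', (∀ x ∈ T, s x = s' x) → lam T s = lam T s') :
    ∑ q ∈ Q n d, F true ((Multiset.range d).map (L lam q)) = al lam d := by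
  classical
  have c2 : ∀ z : ZMod 2, z + z = 0 := by decide
  set e : Fin n := ⟨d, hd⟩
  rw [← Finset.sum_filter_add_sum_filter_not (Q n d) (fun q => q.1 e = e)]
  have h1 : (Q n d).filter (fun q => q.1 e = e) = P n d := by
    ext q
    simp only [Q, P, Finset.mem_filter, Finset.mem_univ, true_and]
    constructor
    · rintro ⟨⟨h1, h2⟩, h3⟩
      refine ⟨fun i hi => ?_, h2⟩
      rcases hi.eq_or_lt with h | h
      · have : i = e := Fin.ext h.symm
        rw [this, h3]
      · exact h1 i h
    · rintro ⟨h1, h2⟩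
      exact ⟨⟨fun i hi => h1 i (by omega), h2⟩, h1 e le_rfl⟩
  rw [h1, al, add_eq_left]
  refine Finset.sum_involution (fun q _ => (q.1, Function.update q.2 (q.1 e) (!q.2 (q.1 e)))) ?_ ?_ ?_ ?_
  · intro q hq
    have : (Multiset.range d).map (L lam (q.1, Function.update q.2 (q.1 e) (!q.2 (q.1 e)))) =
      (Multiset.range d).map (L lam q) := by
      apply Multiset.map_congr rfl
      intro j hj
      unfold L
      apply hloc
      intro x hx
      apply Function.update_of_ne
      rintro rfl
      simp [T, e] at hx hj
      omega
    rw [this]; exact c2 _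
  · intro q hq _ h
    have h1 := congrFun (congrArg Prod.snd h) (q.1 e)
    simp at h1
  · intro q hq
    simp only [Q, Finset.mem_filter, Finset.mem_univ, true_and] at hq ⊢
    refine ⟨⟨hq.1.1, fun i hi => ?_⟩, hq.2⟩
    rw [Function.update_of_ne, hq.1.2 i hi]
    rintro rfl
    rcases hi.eq_or_lt with h | h
    · exact hq.2 (Fin.ext h.symm)
    · have := hq.1.1 _ h
      exact hq.2 (q.1.injective this)
  · intro q hq
    ext : 1 <;> simp

lemma T_sub (q : Ch n) (d : ℕ) (hq : ∀ i : Fin n, d ≤ i.val → q.1 i = i) (j : ℕ) (hj : j ≤ d) (x : Fin n)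
    (hx : x ∈ T q.1 j) : x.val < d := by
  by_contra h
  have h1 := hq x (by omega)
  have : q.1.symm x = x := by rw [Equiv.symm_apply_eq, h1]
  simp [T, this] at hx
  omega

lemma T_ne (π : Equiv.Perm (Fin n)) (j : ℕ) (h : j < n) : (T π (j+1)).Nonempty :=
  ⟨π ⟨0, by omega⟩, by simp [T]⟩

lemma T_mono (π : Equiv.Perm (Fin n)) {i j : ℕ} (h : i ≤ j) : T π i ⊆ T π j := by
  intro x; simp only [T, Finset.mem_filter, Finset.mem_univ, true_and]; omega

lemma nc_map (hnc : ∀ T T' s, T.Nonempty → T ⊆ T' → lev (lam T s) = lev (lam T' s) → sg (lam T s) = sg (lam T' s))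
    (q : Ch n) (d : ℕ) (hd : d ≤ n) :
    ∀ x ∈ (Multiset.range d).map (L lam q), ∀ y ∈ (Multiset.range d).map (L lam q),
      lev x = lev y → sg x = sg y := by
  intro x hx y hy hxy
  obtain ⟨i, hi, rfl⟩ := Multiset.mem_map.1 hx
  obtain ⟨j, hj, rfl⟩ := Multiset.mem_map.1 hy
  rw [Multiset.mem_range] at hi hj
  rcases le_total i j with h | h
  · exact hnc _ _ _ (T_ne _ _ (by omega)) (T_mono _ (by omega)) hxy
  · exact (hnc _ _ _ (T_ne _ _ (by omega)) (T_mono _ (by omega)) hxy.symm).symm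

lemma step (d : ℕ) (hd : d < n)
    (hloc : ∀ T s s', (∀ x ∈ T, s x = s' x) → lam T s = lam T s')
    (hanti : ∀ T s, T.Nonempty → lam T (fun x => !s x) = flp (lam T s))
    (hnc : ∀ T T' s, T.Nonempty → T ⊆ T' → lev (lam T s) = lev (lam T' s) → sg (lam T s) = sg (lam T' s)) :
    al lam (d+1) = al lam d := by
  classical
  set e : Fin n := ⟨d, hd⟩
  have A : ∑ q ∈ Q n d, ∑ i ∈ Finset.range (d+1), F true (((Multiset.range (d+1)).erase i).map (L lam q))
      = al lam d := by
    rw [Finset.sum_comm, Finset.sum_range_succ, Finset.sum_eq_zero, zero_add]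
    · rw [← step_last lam d hd hloc]
      apply Finset.sum_congr rfl
      intro q _
      rw [Multiset.range_succ, Multiset.erase_cons_head]
    · intro i hi
      exact step_swap lam d i hd (Finset.mem_range.1 hi)
  have B : ∀ q : Ch n, ∑ i ∈ Finset.range (d+1), F true (((Multiset.range (d+1)).erase i).map (L lam q))
      = F true ((Multiset.range (d+1)).map (L lam q)) + F false ((Multiset.range (d+1)).map (L lam q)) := by
    intro q
    have := delta ((Multiset.range (d+1)).map (L lam q)) true
    rw [Bool.not_true] at this
    rw [← this, Multiset.map_map]
    change (Multiset.map _ (Multiset.range (d+1))).sum = _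
    congr 1
    apply Multiset.map_congr rfl
    intro i hi
    simp only [Function.comp]
    congr 1
    rw [Multiset.map_erase_of_mem _ _ hi]
  rw [← A, Finset.sum_congr rfl (fun q _ => B q), Finset.sum_add_distrib, al]
  rw [← Finset.sum_filter_add_sum_filter_not (P n (d+1)) (fun q => q.2 e = true)]
  congr 1
  · apply Finset.sum_congr _ (fun _ _ => rfl)
    ext q
    simp only [Q, P, Finset.mem_filter, Finset.mem_univ, true_and]
    constructor
    · rintro ⟨⟨h1, h2⟩, h3⟩
      refine ⟨h1, fun i hi => ?_⟩
      rcases hi.eq_or_lt with h | h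
      · have : i = e := Fin.ext h.symm
        rw [this, h3]
      · exact h2 i h
    · rintro ⟨h1, h2⟩
      exact ⟨⟨h1, fun i hi => h2 i (by omega)⟩, h2 e le_rfl⟩
  · let g : Ch n → Ch n := fun q => (q.1, fun x => if x.val < d+1 then !q.2 x else q.2 x)
    have gg : ∀ q, g (g q) = q := by
      intro q
      ext x
      · rfl
      · simp only [g]; split_ifs <;> simp
    refine Finset.sum_bij' (fun q _ => g q) (fun q _ => g q) ?_ ?_ (fun q _ => gg q) (fun q _ => gg q) ?_
    · intro q hq
      simp only [Q, P, Finset.mem_filter, Finset.mem_univ, true_and] at hq ⊢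
      refine ⟨hq.1.1, fun i hi => ?_⟩
      rcases hi.eq_or_lt with h | h
      · have : i = e := Fin.ext h.symm
        simp [g, this, e, hq.2]
      · have := hq.1.2 i h
        simp [g, this]; omega
    · intro q hq
      simp only [Q, P, Finset.mem_filter, Finset.mem_univ, true_and] at hq ⊢
      refine ⟨⟨hq.1, fun i hi => ?_⟩, ?_⟩
      · have := hq.2 i (by omega)
        simp [g, this]; omega
      · have := hq.2 e le_rfl
        simp [g, this, e]
    · intro q hq
      simp only [P, Finset.mem_filter, Finset.mem_univ, true_and] at hq
      have := F_flp _ (nc_map lam hnc (g q) (d+1) (by omega)) true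
      rw [Bool.not_true] at this
      rw [← this, Multiset.map_map]
      congr 1
      apply Multiset.map_congr rfl
      intro j hj
      rw [Multiset.mem_range] at hj
      simp only [Function.comp, L]
      rw [← hanti _ _ (T_ne _ _ (by omega))]
      apply hloc
      intro x hx
      have := T_sub q (d+1) hq.1.1 (j+1) (by omega) x hx
      simp [g, this]

theorem fan
    (hloc : ∀ T s s', (∀ x ∈ T, s x = s' x) → lam T s = lam T s')
    (hanti : ∀ T s, T.Nonempty → lam T (fun x => !s x) = flp (lam T s))
    (hnc : ∀ T T' s, T.Nonempty → T ⊆ T' → lev (lam T s) = lev (lam T' s) → sg (lam T s) = sg (lam T' s)) :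
    ∃ q : Ch n, F true ((Multiset.range n).map (L lam q)) ≠ 0 := by
  have h : ∀ d, d ≤ n → al lam d = 1 := by
    intro d
    induction d with
    | zero =>
      intro _
      have : P n 0 = {(1, fun _ => true)} := by
        ext q
        simp only [P, Finset.mem_filter, Finset.mem_univ, true_and, Finset.mem_singleton, Nat.zero_le, true_imp_iff]
        constructor
        · rintro ⟨h1, h2⟩
          exact Prod.ext (Equiv.ext h1) (funext h2)
        · rintro rfl; simp
      simp [al, this, F, alt]
    | succ d ih =>
      intro hd
      rw [step lam d (by omega) hloc hanti hnc, ih (by omega)]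
  by_contra hcon
  push Not at hcon
  have := h n le_rfl
  rw [al, Finset.sum_eq_zero (fun q _ => hcon q)] at this
  exact absurd this (by decide)
end fan

lemma alt_sg (l : List Lab) (b : Bool) (h : alt b l ≠ 0) (i : ℕ) (hi : i < l.length) :
    sg l[i] = (if Even i then b else !b) := by
  induction l generalizing b i with
  | nil => simp at hi
  | cons x l ih =>
    rw [alt] at h
    split_ifs at h with h1
    · cases i with
      | zero => simpa using h1
      | succ i =>
        have := ih (!b) h i (by simpa using hi)
        rw [List.getElem_cons_succ, this]
        by_cases he : Even i
        · simp [he, Nat.even_add_one]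
        · simp [he, Nat.even_add_one]
    · exact absurd rfl h

section kneser
open Classical in
noncomputable def G {n : ℕ} (k : ℕ) (T : Finset (Fin n)) (s : Fin n → Bool) : Finset (Finset (Fin n)) :=
  (T.powersetCard k).filter (fun S => ∃ b, ∀ x ∈ S, s x = b)

open Classical in
noncomputable def lam {n : ℕ} (k : ℕ) (c : Finset (Fin n) → ℕ) (T : Finset (Fin n)) (s : Fin n → Bool) : Lab :=
  if (G k T s).Nonempty then
    toLex (2 * k - 1 + (G k T s).sup c,
      decide (∃ S ∈ G k T s, c S = (G k T s).sup c ∧ ∀ x ∈ S, s x = true))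
  else toLex (T.card, decide (∃ h : T.Nonempty, s (T.min' h) = true))

variable {n k : ℕ} {c : Finset (Fin n) → ℕ}

lemma mem_G {T S : Finset (Fin n)} {s : Fin n → Bool} :
    S ∈ G k T s ↔ S ⊆ T ∧ S.card = k ∧ ∃ b, ∀ x ∈ S, s x = b := by
  simp [G, Finset.mem_powersetCard, and_assoc]

lemma G_congr {T : Finset (Fin n)} {s s' : Fin n → Bool} (h : ∀ x ∈ T, s x = s' x) : G k T s = G k T s' := by
  ext S
  rw [mem_G, mem_G]
  refine and_congr_right fun hS => and_congr_right fun _ => exists_congr fun b => ?_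
  exact forall₂_congr fun x hx => by rw [h x (hS hx)]

lemma lam_loc (T : Finset (Fin n)) (s s' : Fin n → Bool) (h : ∀ x ∈ T, s x = s' x) :
    lam k c T s = lam k c T s' := by
  unfold lam
  rw [G_congr h]
  split_ifs
  · congr 3
    rw [eq_iff_iff]
    refine exists_congr fun S => and_congr_right fun hS => and_congr_right fun _ => ?_
    exact forall₂_congr fun x hx => by rw [h x ((mem_G.1 hS).1 hx)]
  · congr 3
    rw [eq_iff_iff]
    exact exists_congr fun hT => by rw [h _ (Finset.min'_mem _ _)]

lemma G_neg {T : Finset (Fin n)} {s : Fin n → Bool} : G k T (fun x => !s x) = G k T s := by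
  ext S
  rw [mem_G, mem_G]
  refine and_congr_right fun hS => and_congr_right fun _ => ?_
  constructor
  · rintro ⟨b, h⟩; exact ⟨!b, fun x hx => by rw [← h x hx]; simp⟩
  · rintro ⟨b, h⟩; exact ⟨!b, fun x hx => by rw [← h x hx]⟩

lemma G_mono {T T' : Finset (Fin n)} {s : Fin n → Bool} (h : T ⊆ T') : G k T s ⊆ G k T' s := by
  intro S hS
  rw [mem_G] at hS ⊢
  exact ⟨hS.1.trans h, hS.2⟩

/-- big label characterization -/
lemma big (hk : 0 < k) (hc : ∀ S S' : Finset (Fin n), S.card = k → S'.card = k → Disjoint S S' → c S ≠ c S')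
    {T : Finset (Fin n)} {s : Fin n → Bool} (hG : (G k T s).Nonempty) :
    lev (lam k c T s) = 2 * k - 1 + (G k T s).sup c ∧
    ∃ S ∈ G k T s, c S = (G k T s).sup c ∧ ∀ x ∈ S, s x = sg (lam k c T s) := by
  unfold lam
  rw [if_pos hG]
  refine ⟨rfl, ?_⟩
  obtain ⟨S, hS, hS'⟩ := Finset.exists_mem_eq_sup _ hG c
  simp only [sg, ofLex_toLex]
  by_cases h : ∃ S ∈ G k T s, c S = (G k T s).sup c ∧ ∀ x ∈ S, s x = true
  · simp only [h, decide_true]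
  · refine ⟨S, hS, hS'.symm, ?_⟩
    obtain ⟨_, _, b, hb⟩ := mem_G.1 hS
    cases b
    · simpa [h] using hb
    · exact absurd ⟨S, hS, hS'.symm, hb⟩ h

lemma same (hk : 0 < k) (hc : ∀ S S' : Finset (Fin n), S.card = k → S'.card = k → Disjoint S S' → c S ≠ c S')
    {S S' : Finset (Fin n)} {s : Fin n → Bool} {b b' : Bool} (h1 : S.card = k) (h2 : S'.card = k)
    (hb : ∀ x ∈ S, s x = b) (hb' : ∀ x ∈ S', s x = b') (h : c S = c S') : b = b' := by
  by_contra hne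
  refine hc S S' h1 h2 ?_ h
  rw [Finset.disjoint_left]
  intro x hx hx'
  exact hne ((hb x hx).symm.trans (hb' x hx'))

lemma small {T : Finset (Fin n)} {s : Fin n → Bool} (hk : 0 < k) (hG : ¬ (G k T s).Nonempty) :
    lam k c T s = toLex (T.card, decide (∃ h : T.Nonempty, s (T.min' h) = true)) ∧ T.card ≤ 2 * k - 2 := by
  refine ⟨by unfold lam; rw [if_neg hG], ?_⟩
  have h : ∀ b, (T.filter (fun x => s x = b)).card < k := by
    intro b
    by_contra hcon
    push Not at hcon
    obtain ⟨S, hS, hS'⟩ := Finset.exists_subset_card_eq hcon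
    exact hG ⟨S, mem_G.2 ⟨hS.trans (Finset.filter_subset _ _), hS', b, fun x hx => (Finset.mem_filter.1 (hS hx)).2⟩⟩
  have h1 := h true
  have h2 := h false
  have h3 := Finset.card_filter_add_card_filter_not (s := T) (fun x => s x = true)
  simp only [Bool.not_eq_true] at h3
  omega

lemma lam_anti (hk : 0 < k) (hc : ∀ S S' : Finset (Fin n), S.card = k → S'.card = k → Disjoint S S' → c S ≠ c S')
    (T : Finset (Fin n)) (s : Fin n → Bool) (hT : T.Nonempty) :
    lam k c T (fun x => !s x) = flp (lam k c T s) := by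
  by_cases hG : (G k T s).Nonempty
  · have hG' : (G k T (fun x => !s x)).Nonempty := by rwa [G_neg]
    obtain ⟨h1, S, hS, hS1, hS2⟩ := big hk hc hG
    obtain ⟨h1', S', hS', hS1', hS2'⟩ := big hk hc hG'
    rw [G_neg] at h1' hS' hS1'
    have := same hk hc (s := s) (b := sg (lam k c T s)) (b' := !sg (lam k c T (fun x => !s x)))
      (mem_G.1 hS).2.1 (mem_G.1 hS').2.1 hS2 (fun x hx => by rw [← hS2' x hx]; simp) (by rw [hS1, hS1'])
    apply (ofLex (α := ℕ × Bool)).injective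
    refine Prod.ext ?_ ?_
    · exact h1'.trans h1.symm
    · change sg _ = !sg _
      rw [this]; simp
  · have hG' : ¬ (G k T (fun x => !s x)).Nonempty := by rwa [G_neg]
    rw [(small hk hG).1, (small hk hG').1]
    simp [flp, lev, sg, hT]

lemma lam_nc (hk : 0 < k) (hc : ∀ S S' : Finset (Fin n), S.card = k → S'.card = k → Disjoint S S' → c S ≠ c S')
    (T T' : Finset (Fin n)) (s : Fin n → Bool) (hT : T.Nonempty) (hTT : T ⊆ T')
    (h : lev (lam k c T s) = lev (lam k c T' s)) : sg (lam k c T s) = sg (lam k c T' s) := by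
  by_cases hG : (G k T s).Nonempty
  · have hG' : (G k T' s).Nonempty := hG.mono (G_mono hTT)
    obtain ⟨h1, S, hS, hS1, hS2⟩ := big hk hc hG
    obtain ⟨h1', S', hS', hS1', hS2'⟩ := big hk hc hG'
    exact same hk hc (mem_G.1 hS).2.1 (mem_G.1 hS').2.1 hS2 hS2' (by rw [hS1, hS1']; omega)
  · by_cases hG' : (G k T' s).Nonempty
    · have h1 := (big hk hc hG').1
      have h2 := small (c := c) hk hG
      rw [h2.1] at h
      simp only [lev, ofLex_toLex] at h h1
      omega
    · have h1 := small (c := c) hk hG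
      have h2 := small (c := c) hk hG'
      rw [h1.1, h2.1] at h
      simp only [lev, ofLex_toLex] at h
      rw [Finset.eq_of_subset_of_card_le hTT h.ge]

theorem zigzag (hk : 0 < k) (hc : ∀ S S' : Finset (Fin n), S.card = k → S'.card = k → Disjoint S S' → c S ≠ c S') :
    ∃ s : Fin n → Bool, ∀ b : Bool, (n - (2 * k - 2) + (if b then 1 else 0)) / 2 ≤
      (((Finset.univ.powersetCard k).filter (fun S => ∀ x ∈ S, s x = b)).image c).card := by
  obtain ⟨q, hq⟩ := fan (lam k c) lam_loc (lam_anti hk hc) (lam_nc hk hc)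
  refine ⟨q.2, ?_⟩
  set M := (Multiset.range n).map (L (lam k c) q) with hM
  have hnc := nc_map (lam k c) (lam_nc hk hc) q n le_rfl
  rw [← hM] at hnc
  unfold F at hq
  set l := M.sort (· ≤ ·) with hl
  have hlen : l.length = n := by simp [hl, hM]
  have hmem : ∀ x ∈ l, x ∈ M := fun x hx => by rwa [hl, Multiset.mem_sort] at hx
  have hs := alt_sg l true hq
  have hsort : l.Pairwise (· ≤ ·) := Multiset.pairwise_sort _ _
  have hstep : ∀ i (hi : i + 1 < l.length), lev l[i] < lev l[i+1] := by
    intro i hi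
    have h1 : l[i] ≤ l[i+1] := List.pairwise_iff_getElem.1 hsort i (i+1) (by omega) hi (by omega)
    refine lt_of_le_of_ne (le_lev h1) fun h => ?_
    have h2 := hnc _ (hmem _ (List.getElem_mem (by omega))) _ (hmem _ (List.getElem_mem hi)) h
    rw [hs i (by omega), hs (i+1) hi] at h2
    by_cases he : Even i <;> simp [he, Nat.even_add_one] at h2
  have hbig : ∀ x ∈ l, 1 ≤ lev x ∧ (2 * k - 1 ≤ lev x → ∃ S : Finset (Fin n), S.card = k ∧ (∀ y ∈ S, q.2 y = sg x) ∧
      c S = lev x - (2 * k - 1)) := by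
    intro x hx
    obtain ⟨j, hj, rfl⟩ := Multiset.mem_map.1 (hmem x hx)
    rw [Multiset.mem_range] at hj
    have hne := T_ne q.1 j hj
    unfold L
    by_cases hG : (G k (T q.1 (j+1)) q.2).Nonempty
    · obtain ⟨h1, S, hS, hS1, hS2⟩ := big hk hc hG
      refine ⟨by omega, fun _ => ⟨S, (mem_G.1 hS).2.1, hS2, by omega⟩⟩
    · have h1 := small (c := c) hk hG
      have := hne.card_pos
      rw [h1.1]
      simp only [lev, ofLex_toLex]
      refine ⟨by omega, fun h => by omega⟩
  have hlev : ∀ i (hi : i < l.length), i + 1 ≤ lev l[i] := by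
    intro i
    induction i with
    | zero => intro hi; exact (hbig _ (List.getElem_mem hi)).1
    | succ i ih =>
      intro hi
      have := ih (by omega)
      have := hstep i hi
      omega
  have hmono : ∀ i j (hj : j < l.length) (hij : i < j), lev l[i] < lev l[j] := by
    intro i j
    induction j with
    | zero => intro _ h; omega
    | succ j ih =>
      intro hj hij
      rcases (Nat.lt_succ_iff.1 hij).eq_or_lt with h | h
      · subst h; exact hstep i hj
      · exact (ih (by omega) h).trans (hstep j hj)
  intro b
  set off := 2 * k - 2 + (if b then 0 else 1) with hoff
  have hin : ∀ j < (n - (2 * k - 2) + (if b then 1 else 0)) / 2, off + 2 * j < l.length := by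
    intro j hj
    rw [hlen, hoff]
    cases b
    · simp at hj ⊢; omega
    · simp at hj ⊢; omega
  let f : ℕ → ℕ := fun j => lev (l.getD (off + 2 * j) (toLex (0, true))) - (2 * k - 1)
  conv_lhs => rw [← Finset.card_range ((n - (2 * k - 2) + (if b then 1 else 0)) / 2)]
  apply Finset.card_le_card_of_injOn f
  · intro j hj
    have hj := Finset.mem_range.1 (Finset.mem_coe.1 hj)
    have h1 := hin j hj
    have h2 := hlev _ h1
    obtain ⟨S, hS, hS1, hS2⟩ := (hbig _ (List.getElem_mem h1)).2 (by omega)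
    rw [Finset.mem_coe, Finset.mem_image]
    refine ⟨S, ?_, ?_⟩
    · rw [Finset.mem_filter, Finset.mem_powersetCard]
      refine ⟨⟨Finset.subset_univ _, hS⟩, fun x hx => ?_⟩
      rw [hS1 x hx, hs _ h1]
      have : Even (2 * k - 2) := ⟨k - 1, by omega⟩
      cases b
      · simp [hoff, this, Nat.even_add]
      · simp [hoff, this, Nat.even_add]
    · simp only [f]
      rw [hS2, List.getD_eq_getElem _ _ h1]
  · intro i hi j hj hij
    have hi := hin i (Finset.mem_range.1 (Finset.mem_coe.1 hi))
    have hj := hin j (Finset.mem_range.1 (Finset.mem_coe.1 hj))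
    simp only [f] at hij
    rw [List.getD_eq_getElem _ _ hi, List.getD_eq_getElem _ _ hj] at hij
    have := hlev _ hi
    have := hlev _ hj
    rcases lt_trichotomy i j with h | h | h
    · have := hmono (off + 2 * i) (off + 2 * j) hj (by omega); omega
    · exact h
    · have := hmono (off + 2 * j) (off + 2 * i) hi (by omega); omega
end kneser

abbrev V (n k : ℕ) := {s : Finset (Fin n) // s.card = k}

def U {n k m : ℕ} (ι : Fin m ↪ Fin n) (s : Fin m → Bool) (b : Bool) : Set (V n k) :=
  {t | ∃ S : Finset (Fin m), t.1 = S.map ι ∧ ∀ x ∈ S, s x = b}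

lemma U_disj {n k m : ℕ} (ι : Fin m ↪ Fin n) (s : Fin m → Bool) {t t' : V n k}
    (h : t ∈ U ι s true) (h' : t' ∈ U ι s false) : Disjoint t.1 t'.1 := by
  obtain ⟨S, hS, h1⟩ := h
  obtain ⟨S', hS', h2⟩ := h'
  rw [hS, hS', Finset.disjoint_map, Finset.disjoint_left]
  intro x hx hx'
  have := (h1 x hx).symm.trans (h2 x hx')
  simp at this

lemma emb {n k m : ℕ} (hk : 0 < k) {Ct : Type*} (c : V n k → Ct)
    (hc : ∀ s t : V n k, Disjoint s.1 t.1 → c s ≠ c t) (ι : Fin m ↪ Fin n) :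
    ∃ s : Fin m → Bool, ∀ b : Bool, (m - (2 * k - 2) + (if b then 1 else 0)) / 2 ≤
      (c '' (U ι s b)).ncard := by
  classical
  obtain ⟨g, hg⟩ := exists_injective_nat (Set.range c)
  let f : V n k → ℕ := fun v => g ⟨c v, v, rfl⟩
  have hf : ∀ v w, f v = f w → c v = c w := fun v w h => congrArg Subtype.val (hg h)
  let c' : Finset (Fin m) → ℕ := fun S => if h : S.card = k then f ⟨S.map ι, by rw [Finset.card_map, h]⟩ else 0
  have hc' : ∀ S S' : Finset (Fin m), S.card = k → S'.card = k → Disjoint S S' → c' S ≠ c' S' := by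
    intro S S' h1 h2 hd he
    simp only [c', h1, h2, dif_pos] at he
    exact hc _ _ (by simpa using hd) (hf _ _ he)
  obtain ⟨s, hs⟩ := zigzag hk hc'
  refine ⟨s, fun b => (hs b).trans ?_⟩
  rw [← Set.ncard_coe_finset]
  have hU : Set.Finite (c '' (U (k := k) ι s b)) := Set.toFinite _
  let r : Ct → ℕ := fun y => if hy : y ∈ Set.range c then g ⟨y, hy⟩ else 0
  have hr : ∀ v, r (c v) = f v := fun v => dif_pos ⟨v, rfl⟩
  refine le_trans (Set.ncard_le_ncard (t := r '' (c '' (U (k := k) ι s b))) ?_ (hU.image _))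
    (Set.ncard_image_le hU)
  intro y hy
  obtain ⟨S, hS, rfl⟩ := Finset.mem_image.1 (Finset.mem_coe.1 hy)
  rw [Finset.mem_filter, Finset.mem_powersetCard] at hS
  refine ⟨_, ⟨⟨S.map ι, by rw [Finset.card_map, hS.1.2]⟩, ⟨S, rfl, hS.2⟩, rfl⟩, ?_⟩
  rw [hr]
  simp only [c', hS.1.2, dif_pos]
end LCK

/-- **Local chromatic bound for Kneser graphs via a prime `p`:** for `k ≥ 2`, `p`
prime, and `n ≥ pk`, every proper coloring of the Kneser graph `KG(n,k)` (vertices: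
`k`-subsets of `[n]`; adjacency: disjointness) has a vertex whose closed neighborhood
receives at least `n − p(k−1) − ⌊(n − p(k−1))/p⌋ + 1` colors. -/
theorem local_chromatic_kneser (k p n : ℕ) (hk : 2 ≤ k) (hp : p.Prime) (hn : p * k ≤ n)
    (Ct : Type*) (c : {s : Finset (Fin n) // s.card = k} → Ct)
    (hc : ∀ s t : {s : Finset (Fin n) // s.card = k},
      Disjoint s.1 t.1 → c s ≠ c t) :
    ∃ s : {s : Finset (Fin n) // s.card = k},
      n - p * (k - 1) - (n - p * (k - 1)) / p + 1 ≤
        (c '' (insert s {t | Disjoint s.1 t.1})).ncard := by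
  have key : ∀ (s : LCK.V n k) (W : Set (LCK.V n k)), W ⊆ {t | Disjoint s.1 t.1} →
      (c '' W).ncard + 1 ≤ (c '' (insert s {t | Disjoint s.1 t.1})).ncard := by
    intro s W hW
    have h1 : c s ∉ c '' W := by
      rintro ⟨t, ht, h⟩
      exact hc s t (hW ht) h.symm
    rw [← Set.ncard_insert_of_notMem h1 (Set.toFinite _), ← Set.image_insert_eq]
    exact Set.ncard_le_ncard (Set.image_mono (Set.insert_subset_insert hW)) (Set.toFinite _)
  rcases hp.two_le.eq_or_lt with h2 | h3
  · subst h2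
    obtain ⟨s, hs⟩ := LCK.emb (by omega) c hc (Function.Embedding.refl (Fin n))
    have ht := hs true
    have hf := hs false
    have e : 2 * (k - 1) = 2 * k - 2 := by omega
    simp only [if_true, Bool.false_eq_true, if_false] at ht hf
    obtain ⟨_, t0, ht0, _⟩ := Set.nonempty_of_ncard_ne_zero
      (s := c '' (LCK.U (Function.Embedding.refl (Fin n)) s false)) (by omega)
    refine ⟨t0, le_trans ?_ (key t0 (LCK.U (Function.Embedding.refl (Fin n)) s true)
      (fun t ht => (LCK.U_disj _ _ ht ht0).symm))⟩
    omega
  · have hp3 : 3 ≤ p := h3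
    have h3k : 3 * k ≤ n := (Nat.mul_le_mul_right k hp3).trans hn
    obtain ⟨S, -, hS⟩ := Finset.exists_subset_card_eq (s := (Finset.univ : Finset (Fin n))) (n := k)
      (by rw [Finset.card_univ, Fintype.card_fin]; omega)
    have hcard : (Sᶜ).card = n - k := by rw [Finset.card_compl, Fintype.card_fin, hS]
    let ι := (Sᶜ.orderEmbOfFin hcard).toEmbedding
    obtain ⟨s, hs⟩ := LCK.emb (by omega) c hc ι
    have ht := hs true
    have hf := hs false
    simp only [if_true, Bool.false_eq_true, if_false] at ht hf
    refine ⟨⟨S, hS⟩, le_trans ?_ (key ⟨S, hS⟩ (LCK.U ι s true ∪ LCK.U ι s false) ?_)⟩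
    · rw [Set.image_union, Set.ncard_union_eq ?_ (Set.toFinite _) (Set.toFinite _)]
      · have a1 : 3 * (k - 1) ≤ p * (k - 1) := Nat.mul_le_mul_right _ hp3
        have a2 : p * (k - 1) + p = p * k := by
          obtain ⟨j, rfl⟩ : ∃ j, k = j + 1 := ⟨k - 1, by omega⟩
          simp [mul_add]
        have a3 : 1 ≤ (n - p * (k - 1)) / p := (Nat.one_le_div_iff (by omega)).2 (by omega)
        omega
      · rw [Set.disjoint_left]
        rintro _ ⟨t, ht, rfl⟩ ⟨t', ht', h⟩
        exact hc t t' (LCK.U_disj _ _ ht ht') h.symm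
    · have : ∀ b, ∀ t ∈ LCK.U (k := k) ι s b, Disjoint S t.1 := by
        rintro b t ⟨R, hR, _⟩
        rw [hR, Finset.disjoint_right]
        intro x hx
        obtain ⟨y, _, rfl⟩ := Finset.mem_map.1 hx
        have := Finset.orderEmbOfFin_mem Sᶜ hcard y
        exact Finset.mem_compl.1 this
      rintro t (h | h)
      · exact this _ t h
      · exact this _ t h
end

section
/- Let p be a prime and let G be a nonempty finite simple graph with ω(G) ≥ p, properly colored with an arbitrary number of colors. Then G contains a multicolored complete p-partite subgraph K_{n_1, …, n_p} (i.e., there exist pairwise disjoint nonempty... possibly some empty... sets U_1, …, U_p ⊆ V(G), |U_i| = n_i, such that every two vertices in distinct sets are adjacent and all vertices of U_1 ∪ ⋯ ∪ U_p receive pairwise distinct colors) with n_1 + ⋯ + n_p = Xind_{Z_p}(Hom(K_p, G)) + p and |n_i − n_j| ≤ 1 for all i, j ∈ [p]. -/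
lemma aux_free {A : Type*} (p : ℕ) (hp : p.Prime) (f : ZMod p → A) (d : ZMod p) (hd : d ≠ 0)
    (h : ∀ i, f (i + d) = f i) (i j : ZMod p) : f i = f j := by
  haveI : Fact p.Prime := ⟨hp⟩
  have key : ∀ k : ℕ, f ((k : ZMod p) * d) = f 0 := by
    intro k
    induction k with
    | zero => simp
    | succ k ih => rw [← ih, ← h ((k : ZMod p) * d)]; congr 1; push_cast; ring
  have key2 : ∀ i, f i = f 0 := by
    intro i
    have := key (i / d).val
    rw [ZMod.natCast_val, ZMod.cast_id', id, div_mul_cancel₀ _ hd] at this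
    exact this
  rw [key2 i, key2 j]

lemma aux_sign (A : Type*) (p : ℕ) (hp : p.Prime) :
    ∃ σ : (ZMod p → A) → ZMod p, ∀ (f : ZMod p → A) (ε : ZMod p), (∃ i j, f i ≠ f j) →
      σ (fun i => f (i + ε)) = ε + σ f := by
  classical
  let s : Setoid (ZMod p → A) :=
    { r := fun f g => ∃ ε, ∀ i, g i = f (i + ε)
      iseqv :=
        { refl := fun f => ⟨0, fun i => by simp⟩
          symm := by
            rintro f g ⟨ε, h⟩
            exact ⟨-ε, fun i => by rw [h]; simp⟩
          trans := by
            rintro f g k ⟨ε, h⟩ ⟨δ, h'⟩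
            exact ⟨δ + ε, fun i => by rw [h', h, add_assoc]⟩ } }
  let r : (ZMod p → A) → (ZMod p → A) := fun f => (Quotient.mk s f).out
  have hr : ∀ f, ∃ ε, ∀ i, f i = r f (i + ε) := fun f => Quotient.mk_out (s := s) f
  choose σ hσ using hr
  refine ⟨σ, fun f ε hf => ?_⟩
  have hrr : r (fun i => f (i + ε)) = r f := by
    have : Quotient.mk s (fun i => f (i + ε)) = Quotient.mk s f :=
      Quotient.sound (s := s) (s.symm ⟨ε, fun i => rfl⟩)
    simp only [r, this]
  by_contra hne
  obtain ⟨i, j, hij⟩ := hf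
  apply hij
  have h1 := hσ (fun i => f (i + ε))
  rw [hrr] at h1
  have h2 := hσ f
  rw [h2 i, h2 j]
  refine aux_free p hp (r f) (ε + σ f - σ (fun i => f (i + ε))) (fun h => hne (sub_eq_zero.1 h).symm) ?_ _ _
  intro k
  have a := h1 (k - σ (fun i => f (i + ε)))
  have b := h2 (k - σ (fun i => f (i + ε)) + ε)
  rw [sub_add_cancel] at a
  rw [← a]
  rw [b]
  congr 1
  ring

noncomputable def auxH {p : ℕ} [NeZero p] (a : ZMod p → ℕ) : ℕ :=
  Finset.univ.inf' ⟨0, Finset.mem_univ _⟩ a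

noncomputable def auxS {p : ℕ} [NeZero p] (a : ZMod p → ℕ) : Finset (ZMod p) :=
  Finset.univ.filter (fun i => auxH a < a i)

noncomputable def auxL {p : ℕ} [NeZero p] (a : ZMod p → ℕ) : ℕ :=
  p * auxH a + (auxS a).card

lemma auxH_le {p : ℕ} [NeZero p] (a : ZMod p → ℕ) (i : ZMod p) : auxH a ≤ a i :=
  Finset.inf'_le _ (Finset.mem_univ i)

lemma le_auxH {p : ℕ} [NeZero p] (a : ZMod p → ℕ) (n : ℕ) (h : ∀ i, n ≤ a i) : n ≤ auxH a :=
  Finset.le_inf' _ _ (fun i _ => h i)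

lemma auxH_ex {p : ℕ} [NeZero p] (a : ZMod p → ℕ) : ∃ i, auxH a = a i := by
  obtain ⟨i, _, h⟩ := Finset.exists_mem_eq_inf' (s := Finset.univ) ⟨(0 : ZMod p), Finset.mem_univ _⟩ a
  exact ⟨i, h⟩

lemma auxS_lt {p : ℕ} [NeZero p] (a : ZMod p → ℕ) : (auxS a).card < p := by
  obtain ⟨i, hi⟩ := auxH_ex a
  have : auxS a ⊂ Finset.univ := by
    refine Finset.ssubset_univ_iff.2 (fun h => ?_)
    have : i ∈ auxS a := h ▸ Finset.mem_univ i
    simp [auxS, hi] at this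
  simpa [ZMod.card] using Finset.card_lt_card this

lemma auxL_mono {p : ℕ} [NeZero p] (a b : ZMod p → ℕ) (h : ∀ i, a i ≤ b i) :
    auxL a < auxL b ∨ (auxL a = auxL b ∧ auxH a = auxH b ∧ auxS a = auxS b) := by
  have h1 : auxH a ≤ auxH b := le_auxH _ _ (fun i => (auxH_le a i).trans (h i))
  rcases h1.lt_or_eq with h2 | h2
  · left
    have := auxS_lt a
    have h3 : p * (auxH a + 1) ≤ p * auxH b := Nat.mul_le_mul_left _ h2
    unfold auxL
    rw [mul_add] at h3
    omega
  · have hs : auxS a ⊆ auxS b := by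
      intro i hi
      simp only [auxS, Finset.mem_filter, Finset.mem_univ, true_and] at hi ⊢
      have := h i
      omega
    have hc := Finset.card_le_card hs
    rcases hc.lt_or_eq with h3 | h3
    · left; unfold auxL; rw [h2]; omega
    · right
      refine ⟨by unfold auxL; rw [h2, h3], h2, Finset.eq_of_subset_of_card_le hs h3.ge⟩

lemma auxH_shift {p : ℕ} [NeZero p] (a : ZMod p → ℕ) (ε : ZMod p) :
    auxH (fun i => a (i + ε)) = auxH a := by
  apply le_antisymm
  · refine le_auxH _ _ (fun i => ?_)
    have := auxH_le (fun i => a (i + ε)) (i - ε)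
    simpa using this
  · exact le_auxH _ _ (fun i => auxH_le a _)

lemma auxS_shift {p : ℕ} [NeZero p] (a : ZMod p → ℕ) (ε : ZMod p) (i : ZMod p) :
    i ∈ auxS (fun i => a (i + ε)) ↔ i + ε ∈ auxS a := by
  simp [auxS, auxH_shift]

lemma auxL_shift {p : ℕ} [NeZero p] (a : ZMod p → ℕ) (ε : ZMod p) :
    auxL (fun i => a (i + ε)) = auxL a := by
  unfold auxL
  rw [auxH_shift]
  congr 1
  refine Finset.card_bij (fun i _ => i + ε) (fun i hi => (auxS_shift a ε i).1 hi)
    (fun i _ j _ h => add_right_cancel h) (fun j hj => ⟨j - ε, ?_, by simp⟩)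
  rw [auxS_shift]; simpa using hj

lemma auxL_extract {p : ℕ} [NeZero p] (a : ZMod p → ℕ) (m : ℕ) (hm : m ≤ auxL a) :
    ∃ b : ZMod p → ℕ, (∀ i, b i ≤ a i) ∧ ∑ i, b i = m ∧ ∀ i j, b i ≤ b j + 1 := by
  classical
  have hp : 0 < p := Nat.pos_of_ne_zero (NeZero.ne p)
  have hdm := Nat.div_add_mod m p
  have hr := Nat.mod_lt m hp
  set q := m / p
  set r := m % p
  have hS := auxS_lt a
  unfold auxL at hm
  have main : ∃ R : Finset (ZMod p), R.card = r ∧ ∀ i, q + (if i ∈ R then 1 else 0) ≤ a i := by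
    by_cases hq : q < auxH a
    · obtain ⟨R, _, hR⟩ := Finset.exists_subset_card_eq (s := (Finset.univ : Finset (ZMod p)))
        (n := r) (by simp [ZMod.card]; omega)
      refine ⟨R, hR, fun i => ?_⟩
      have := auxH_le a i
      split_ifs <;> omega
    · have hqh : q = auxH a := by
        by_contra hne
        have h1 : auxH a + 1 ≤ q := by omega
        have := Nat.mul_le_mul_left p h1
        rw [mul_add] at this
        omega
      obtain ⟨R, hRs, hR⟩ := Finset.exists_subset_card_eq (s := auxS a) (n := r) (by
        rw [hqh] at hdm; omega)
      refine ⟨R, hR, fun i => ?_⟩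
      have := auxH_le a i
      split_ifs with hi
      · have := hRs hi
        simp only [auxS, Finset.mem_filter, Finset.mem_univ, true_and] at this
        omega
      · omega
  obtain ⟨R, hR, hle⟩ := main
  refine ⟨fun i => q + (if i ∈ R then 1 else 0), hle, ?_, ?_⟩
  · rw [Finset.sum_add_distrib]
    simp [ZMod.card, hR]
    exact hdm
  · intro i j
    dsimp only
    split_ifs <;> omega

lemma aux_big {V : Type*} [Fintype V] [DecidableEq V]
    (G : SimpleGraph V)
    (p : ℕ) [NeZero p] (hp : p.Prime) (hω : ∃ S : Finset V, G.IsNClique p S)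
    (Ct : Type*) [DecidableEq Ct] (c : V → Ct) (hc : ∀ u v, G.Adj u v → c u ≠ c v) :
    ∃ x, HomElemG G p x ∧ XindG G p + p ≤ auxL (fun i => ((x i).image c).card) := by
  classical
  have hL1 : ∀ x, HomElemG G p x → p ≤ auxL (fun i => ((x i).image c).card) := by
    intro x hx
    have : 1 ≤ auxH (fun i => ((x i).image c).card) :=
      le_auxH _ _ (fun i => Finset.card_pos.2 ((hx.1 i).image c))
    have := Nat.mul_le_mul_left p this
    unfold auxL
    omega
  rcases Nat.eq_zero_or_pos (XindG G p) with h0 | hpos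
  · obtain ⟨S, hS⟩ := hω
    have e : ZMod p ≃ S := Fintype.equivOfCardEq (by simp [ZMod.card, hS.card_eq])
    have hne : ∀ i j, i ≠ j → (e i : V) ≠ e j := fun i j h h' => h (e.injective (Subtype.ext h'))
    have hx : HomElemG G p (fun i => {(e i : V)}) := by
      refine ⟨fun i => by simp, fun i j h => by simpa using hne i j h, fun i j h u hu v hv => ?_⟩
      simp only [Finset.mem_singleton] at hu hv
      subst hu hv
      exact hS.isClique (e i).2 (e j).2 (hne i j h)
    exact ⟨_, hx, by rw [h0, zero_add]; exact hL1 _ hx⟩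
  · by_contra hcon
    push Not at hcon
    obtain ⟨k, hk⟩ : ∃ k, XindG G p = k + 1 := ⟨XindG G p - 1, by omega⟩
    rw [hk] at hcon
    have hnot := Nat.notMem_of_lt_sInf (show k < XindG G p by omega)
    apply hnot
    obtain ⟨σ, hσ⟩ := aux_sign (Finset Ct × Prop) p hp
    let a : (ZMod p → Finset V) → ZMod p → ℕ := fun x i => ((x i).image c).card
    let T : (ZMod p → Finset V) → ZMod p → Finset Ct × Prop :=
      fun x i => (if auxS (a x) = ∅ then (x i).image c else ∅, i ∈ auxS (a x))
    have hpos' : ∀ x, HomElemG G p x → auxL (a x) - p < k + 1 := by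
      intro x hx
      have := hcon x hx
      have := hL1 x hx
      simp only [a]
      omega
    refine ⟨fun x => (σ (T x), Fin.ofNat (k + 1) (auxL (a x) - p)), ?_, ?_⟩
    · intro x y hx hy hxy
      have h1 := auxL_mono (a x) (a y) (fun i => Finset.card_le_card (Finset.image_subset_image (hxy i)))
      have hx1 := hL1 x hx
      rcases h1 with h1 | ⟨h1, h2, h3⟩
      · left
        simp only [Fin.lt_def, Fin.val_ofNat]
        rw [Nat.mod_eq_of_lt (hpos' x hx), Nat.mod_eq_of_lt (hpos' y hy)]
        change p ≤ auxL (a x) at hx1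
        omega
      · right
        have hT : T x = T y := by
          funext i
          simp only [T, h3]
          congr 1
          split_ifs with he
          · refine Finset.eq_of_subset_of_card_le (Finset.image_subset_image (hxy i)) ?_
            have h4 : i ∉ auxS (a y) := by simp [he]
            simp only [auxS, Finset.mem_filter, Finset.mem_univ, true_and, not_lt] at h4
            have h5 := auxH_le (a x) i
            exact h4.trans (h2 ▸ h5)
          · rfl
        simp only [hT, h1]
    · intro ε x hx
      have ha : a (fun i => x (i + ε)) = fun i => a x (i + ε) := rfl
      have he : auxS (a (fun i => x (i + ε))) = ∅ ↔ auxS (a x) = ∅ := by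
        simp only [Finset.eq_empty_iff_forall_notMem, ha, auxS_shift]
        exact ⟨fun h i => by simpa using h (i - ε), fun h i => h _⟩
      have hT : T (fun i => x (i + ε)) = fun i => T x (i + ε) := by
        funext i
        simp only [T, he]
        congr 1
        rw [ha, auxS_shift]
      have hnc : ∃ i j, T x i ≠ T x j := by
        by_cases hE : auxS (a x) = ∅
        · haveI : Fact p.Prime := ⟨hp⟩
          refine ⟨0, 1, fun h => ?_⟩
          have h := congrArg Prod.fst h
          simp only [T, hE, if_true] at h
          obtain ⟨u, hu⟩ := hx.1 0
          have : c u ∈ (x 1).image c := h ▸ Finset.mem_image_of_mem c hu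
          obtain ⟨v, hv, hvu⟩ := Finset.mem_image.1 this
          exact hc u v (hx.2.2 0 1 zero_ne_one u hu v hv) hvu.symm
        · obtain ⟨i, hi⟩ := Finset.nonempty_iff_ne_empty.2 hE
          obtain ⟨j, hj⟩ := auxH_ex (a x)
          refine ⟨i, j, fun h => ?_⟩
          have h := congrArg Prod.snd h
          simp only [T] at h
          rw [h] at hi
          simp [auxS, hj] at hi
      simp only [hT, hσ (T x) ε hnc, ha, auxL_shift]

theorem multicolored_complete_multipartite {V : Type*} [Fintype V] [DecidableEq V]
    (G : SimpleGraph V) (hG : ∃ u v, G.Adj u v)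
    (p : ℕ) [NeZero p] (hp : p.Prime) (hω : ∃ S : Finset V, G.IsNClique p S)
    (Ct : Type*) (c : V → Ct) (hc : ∀ u v, G.Adj u v → c u ≠ c v) :
    ∃ U : ZMod p → Finset V,
      (∀ i j, i ≠ j → Disjoint (U i) (U j)) ∧
      (∀ i j, i ≠ j → ∀ u ∈ U i, ∀ v ∈ U j, G.Adj u v) ∧
      Set.InjOn c (⋃ i, ↑(U i)) ∧
      (∑ i, (U i).card) = XindG G p + p ∧
      (∀ i j, (U i).card ≤ (U j).card + 1) := by
  classical
  obtain ⟨x, hx, hL⟩ := aux_big G p hp hω Ct c hc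
  obtain ⟨b, hb, hsum, hbal⟩ := auxL_extract _ _ hL
  have hex : ∀ i, ∃ W : Finset V, W ⊆ x i ∧ W.card = b i ∧ Set.InjOn c W := by
    intro i
    obtain ⟨I, hI, hIc⟩ := Finset.exists_subset_card_eq (hb i)
    have : ∀ t : I, ∃ v ∈ x i, c v = t := fun t => Finset.mem_image.1 (hI t.2)
    choose g hg hgc using this
    refine ⟨Finset.univ.image g, ?_, ?_, ?_⟩
    · intro v hv
      obtain ⟨t, _, rfl⟩ := Finset.mem_image.1 hv
      exact hg t
    · rw [Finset.card_image_of_injective]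
      · simp [hIc]
      · intro s t h
        apply Subtype.ext
        rw [← hgc s, ← hgc t, h]
    · intro u hu v hv huv
      obtain ⟨s, _, rfl⟩ := Finset.mem_image.1 (Finset.mem_coe.1 hu)
      obtain ⟨t, _, rfl⟩ := Finset.mem_image.1 (Finset.mem_coe.1 hv)
      rw [hgc, hgc] at huv
      rw [Subtype.ext huv]
  choose U hU hUc hUi using hex
  have hadj : ∀ i j, i ≠ j → ∀ u ∈ U i, ∀ v ∈ U j, G.Adj u v :=
    fun i j h u hu v hv => hx.2.2 i j h u (hU i hu) v (hU j hv)
  refine ⟨U, fun i j h => Finset.disjoint_of_subset_left (hU i)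
    (Finset.disjoint_of_subset_right (hU j) (hx.2.1 i j h)), hadj, ?_, ?_, ?_⟩
  · intro u hu v hv huv
    obtain ⟨i, hi⟩ := Set.mem_iUnion.1 hu
    obtain ⟨j, hj⟩ := Set.mem_iUnion.1 hv
    by_cases hij : i = j
    · subst hij
      exact hUi i hi hj huv
    · exact absurd huv (hc u v (hadj i j hij u hi v hj))
  · simp only [hUc, hsum]
  · intro i j
    rw [hUc, hUc]
    exact hbal i j
end

section
/- (Zig-zag theorem) Let G be a nonempty finite simple graph properly colored with colors from a linearly ordered set, and set t = Xind_{Z_2}(Hom(K_2, G)) + 2. Then G contains a multicolored complete bipartite subgraph K_{⌈t/2⌉, ⌊t/2⌋}; moreover, the t distinct colors appearing on this subgraph, listed in increasing order, alternate between the two sides of the bipartite subgraph (the side of size ⌈t/2⌉ receives the 1st, 3rd, 5th, … smallest of these colors and the other side receives the 2nd, 4th, 6th, … smallest). -/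
def AltG {V : Type*} {Ct : Type*} [LinearOrder Ct] (c : V → Ct)
    (x : ZMod 2 → Finset V) (s : ZMod 2) (k : ℕ) : Prop :=
  ∃ f : ℕ → V, (∀ i, i < k → f i ∈ x (s + (i : ZMod 2))) ∧
    (∀ i j, i < j → j < k → c (f i) < c (f j))

theorem AltG.le_card {V : Type*} [Fintype V] {Ct : Type*} [LinearOrder Ct] {c : V → Ct}
    {x : ZMod 2 → Finset V} {s : ZMod 2} {k : ℕ} (h : AltG c x s k) :
    k ≤ Fintype.card V := by
  obtain ⟨f, -, hf⟩ := h
  have hinj : Function.Injective (fun i : Fin k => f i) := by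
    intro i j hij
    have hij' : f i = f j := hij
    rcases lt_trichotomy (i : ℕ) j with h | h | h
    · have := hf i j h j.2
      rw [hij'] at this
      exact absurd this (lt_irrefl _)
    · exact Fin.ext h
    · have := hf j i h i.2
      rw [hij'] at this
      exact absurd this (lt_irrefl _)
  simpa using Fintype.card_le_of_injective _ hinj

theorem AltG.cons {V : Type*} {Ct : Type*} [LinearOrder Ct] {c : V → Ct}
    {x : ZMod 2 → Finset V} {s : ZMod 2} {k : ℕ} {g : ℕ → V} {v : V}
    (hv : v ∈ x s) (hvg : c v < c (g 0))
    (hg : ∀ i, i < k → g i ∈ x (s + 1 + (i : ZMod 2)))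
    (hg' : ∀ i j, i < j → j < k → c (g i) < c (g j)) : AltG c x s (k + 1) := by
  refine ⟨fun i => Nat.casesOn i v g, ?_, ?_⟩
  · rintro (_ | i) hi
    · simpa using hv
    · have := hg i (by omega)
      have e : s + ((i + 1 : ℕ) : ZMod 2) = s + 1 + (i : ZMod 2) := by push_cast; ring
      rw [e]; exact this
  · rintro (_ | i) (_ | j) hij hj
    · omega
    · change c v < c (g j)
      rcases Nat.eq_zero_or_pos j with rfl | h
      · exact hvg
      · exact hvg.trans (hg' 0 j h (by omega))
    · omega
    · exact hg' i j (by omega) (by omega)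

theorem AltG.extend {V : Type*} [DecidableEq V] {G : SimpleGraph V}
    {Ct : Type*} [LinearOrder Ct] {c : V → Ct} (hc : ∀ u v, G.Adj u v → c u ≠ c v)
    {x : ZMod 2 → Finset V} (hx : HomElemG G 2 x) {s s' : ZMod 2} {k : ℕ} (hk : 0 < k)
    (hs : AltG c x s k) (hs' : AltG c x s' k) (hne : s ≠ s') :
    ∃ s'', AltG c x s'' (k + 1) := by
  obtain ⟨f, hf, hf'⟩ := hs
  obtain ⟨g, hg, hg'⟩ := hs'
  have e1 : s' = s + 1 := by
    have key : ∀ a b : ZMod 2, a ≠ b → b = a + 1 := by decide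
    exact key _ _ hne
  have e2 : s = s' + 1 := by
    have key : ∀ a b : ZMod 2, a ≠ b → b = a + 1 := by decide
    exact key _ _ hne.symm
  have f0 : f 0 ∈ x s := by simpa using hf 0 hk
  have g0 : g 0 ∈ x s' := by simpa using hg 0 hk
  rcases lt_or_gt_of_ne (hc _ _ (hx.2.2 s s' hne _ f0 _ g0)) with h | h
  · exact ⟨s, AltG.cons f0 h (by rw [← e1]; exact hg) hg'⟩
  · exact ⟨s', AltG.cons g0 h (by rw [← e2]; exact hf) hf'⟩

theorem HomElemG.altTwo {V : Type*} [DecidableEq V] {G : SimpleGraph V}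
    {Ct : Type*} [LinearOrder Ct] {c : V → Ct} (hc : ∀ u v, G.Adj u v → c u ≠ c v)
    {x : ZMod 2 → Finset V} (hx : HomElemG G 2 x) : ∃ s, AltG c x s 2 := by
  obtain ⟨u, hu⟩ := hx.1 0
  obtain ⟨v, hv⟩ := hx.1 1
  refine AltG.extend hc hx one_pos (s := 0) (s' := 1) ⟨fun _ => u, ?_, ?_⟩
    ⟨fun _ => v, ?_, ?_⟩ (by decide)
  · intro i hi
    obtain rfl : i = 0 := by omega
    simpa using hu
  · intro i j _ _; omega
  · intro i hi
    obtain rfl : i = 0 := by omega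
    simpa using hv
  · intro i j _ _; omega

theorem altG_shift {V : Type*} {Ct : Type*} [LinearOrder Ct] {c : V → Ct}
    {x : ZMod 2 → Finset V} {s ε : ZMod 2} {k : ℕ} :
    AltG c (fun i => x (i + ε)) s k ↔ AltG c x (s + ε) k := by
  unfold AltG
  have : ∀ i : ℕ, s + (i : ZMod 2) + ε = s + ε + (i : ZMod 2) := fun i => by ring
  simp only [this]

theorem homElemG_shift {V : Type*} [DecidableEq V] {G : SimpleGraph V}
    {x : ZMod 2 → Finset V} (hx : HomElemG G 2 x) (ε : ZMod 2) :
    HomElemG G 2 (fun i => x (i + ε)) :=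
  ⟨fun i => hx.1 _, fun i j h => hx.2.1 _ _ (by simpa using h),
    fun i j h => hx.2.2 _ _ (by simpa using h)⟩

theorem AltG.mono {V : Type*} {Ct : Type*} [LinearOrder Ct] {c : V → Ct}
    {x y : ZMod 2 → Finset V} (h : ∀ i, x i ⊆ y i) {s : ZMod 2} {k : ℕ}
    (hx : AltG c x s k) : AltG c y s k := by
  obtain ⟨f, hf, hf'⟩ := hx
  exact ⟨f, fun i hi => h _ (hf i hi), hf'⟩

theorem zmod2_cases : ∀ i j : ZMod 2, i ≠ j → (i = 0 ∧ j = 1) ∨ (i = 1 ∧ j = 0) := by decide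

theorem zmod2_add_self : ∀ e : ZMod 2, e + e = 0 := by decide

theorem exists_alt {V : Type*} [Fintype V] [DecidableEq V]
    (G : SimpleGraph V) (hG : ∃ u v, G.Adj u v)
    (Ct : Type*) [LinearOrder Ct] (c : V → Ct) (hc : ∀ u v, G.Adj u v → c u ≠ c v) :
    ∃ x, HomElemG G 2 x ∧ ∃ s, AltG c x s (XindG G 2 + 2) := by
  classical
  -- the maximal alternation of each element
  have hmax : ∀ x, ∃ p : ZMod 2 × ℕ, HomElemG G 2 x →
      (AltG c x p.1 p.2 ∧ 2 ≤ p.2 ∧ ∀ s k, AltG c x s k → k ≤ p.2) := by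
    intro x
    by_cases hx : HomElemG G 2 x
    · have h2 := hx.altTwo hc
      obtain ⟨s2, hs2⟩ := h2
      have hb := Nat.findGreatest_spec (P := fun k => ∃ s, AltG c x s k) hs2.le_card ⟨s2, hs2⟩
      obtain ⟨s, hs⟩ := hb
      exact ⟨(s, _), fun _ => ⟨hs, Nat.le_findGreatest hs2.le_card ⟨s2, hs2⟩,
        fun s' k hk => Nat.le_findGreatest hk.le_card ⟨s', hk⟩⟩⟩
    · exact ⟨(0, 0), fun h => absurd h hx⟩
  choose p hp using hmax
  have huniq : ∀ x, HomElemG G 2 x → ∀ s, AltG c x s (p x).2 → s = (p x).1 := by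
    intro x hx s hs
    by_contra hne
    obtain ⟨h1, h2, h3⟩ := hp x hx
    obtain ⟨s'', h⟩ := AltG.extend hc hx (by omega) hs h1 hne
    have := h3 _ _ h
    omega
  -- a hom element
  obtain ⟨u, v, huv⟩ := hG
  have hx0 : ∃ x0, HomElemG G 2 x0 := by
    refine ⟨fun i => if i = 0 then {u} else {v}, ?_, ?_, ?_⟩
    · intro i; dsimp only; split_ifs <;> simp
    · intro i j hij
      have : (i = 0 ∧ j = 1) ∨ (i = 1 ∧ j = 0) := zmod2_cases i j hij
      rcases this with ⟨rfl, rfl⟩ | ⟨rfl, rfl⟩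
      · simp [huv.ne]
      · simp [huv.ne']
    · intro i j hij
      have : (i = 0 ∧ j = 1) ∨ (i = 1 ∧ j = 0) := zmod2_cases i j hij
      rcases this with ⟨rfl, rfl⟩ | ⟨rfl, rfl⟩
      · simp [huv]
      · simp [huv.symm]
  obtain ⟨x0, hx0⟩ := hx0
  obtain ⟨xm, hxm, hM⟩ := Set.exists_max_image {x | HomElemG G 2 x} (fun x => (p x).2)
    (Set.toFinite _) ⟨x0, hx0⟩
  have hxm' : HomElemG G 2 xm := hxm
  obtain ⟨a1, a2, a3⟩ := hp xm hxm'
  have hle : XindG G 2 ≤ (p xm).2 - 2 := by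
    apply Nat.sInf_le
    refine ⟨fun x => ((p x).1, ⟨min ((p x).2 - 2) ((p xm).2 - 2), by omega⟩), ?_, ?_⟩
    · intro x y hx hy hxy
      obtain ⟨b1, b2, b3⟩ := hp x hx
      obtain ⟨d1, d2, d3⟩ := hp y hy
      have l1 := d3 _ _ (b1.mono hxy)
      have l2 : (p y).2 ≤ (p xm).2 := hM y hy
      rcases l1.lt_or_eq with h | h
      · left
        simp only [Fin.lt_def]
        omega
      · right
        have := huniq y hy (p x).1 (by rw [← h]; exact b1.mono hxy)
        simp only [this, h]
    · intro ε x hx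
      have hx' := homElemG_shift hx ε
      obtain ⟨b1, b2, b3⟩ := hp x hx
      obtain ⟨d1, d2, d3⟩ := hp _ hx'
      have e0 : ε + ε = 0 := zmod2_add_self ε
      have l1 := b3 _ _ (altG_shift.1 d1)
      have b1' : AltG c (fun i => x (i + ε)) (ε + (p x).1) (p x).2 := by
        rw [altG_shift]
        have : ε + (p x).1 + ε = (p x).1 := by
          rw [add_right_comm, e0, zero_add]
        rwa [this]
      have l2 := d3 _ _ b1'
      have l := le_antisymm l1 l2
      have := huniq _ hx' (ε + (p x).1) (by rw [l]; exact b1')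
      simp only [← this, l]
  refine ⟨xm, hxm', (p xm).1, ?_⟩
  obtain ⟨f, hf, hf'⟩ := a1
  exact ⟨f, fun i hi => hf i (by omega), fun i j hij hj => hf' i j hij (by omega)⟩

theorem card_filter_even (t : ℕ) :
    ((Finset.range t).filter (fun i => i % 2 = 0)).card = (t + 1) / 2 ∧
    ((Finset.range t).filter (fun i => i % 2 = 1)).card = t / 2 := by
  induction t with
  | zero => simp
  | succ n ih =>
    rw [Finset.range_add_one, Finset.filter_insert, Finset.filter_insert]
    rcases Nat.mod_two_eq_zero_or_one n with h | h
    · simp [h, ih]; omega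
    · simp [h, ih]; omega

/-- **Zig-zag theorem:** a nonempty graph `G` properly colored with linearly ordered
colors contains a multicolored complete bipartite subgraph `K_{⌈t/2⌉, ⌊t/2⌋}` with
`t = Xind(Hom(K_2, G)) + 2`, on which the colors, in increasing order, alternate
between the two sides (the enumeration `f` lists its vertices in increasing color
order, even positions on side `A`, odd positions on side `B`). -/
theorem zig_zag {V : Type*} [Fintype V] [DecidableEq V]
    (G : SimpleGraph V) (hG : ∃ u v, G.Adj u v)
    (Ct : Type*) [LinearOrder Ct] (c : V → Ct) (hc : ∀ u v, G.Adj u v → c u ≠ c v) :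
    ∃ A B : Finset V, Disjoint A B ∧
      A.card = (XindG G 2 + 2 + 1) / 2 ∧
      B.card = (XindG G 2 + 2) / 2 ∧
      (∀ a ∈ A, ∀ b ∈ B, G.Adj a b) ∧
      Set.InjOn c (↑A ∪ ↑B) ∧
      ∃ f : Fin (XindG G 2 + 2) → V,
        StrictMono (fun i => c (f i)) ∧
        (∀ v ∈ A ∪ B, ∃ i, f i = v) ∧
        (∀ i : Fin (XindG G 2 + 2),
          ((i : ℕ) % 2 = 0 → f i ∈ A) ∧ ((i : ℕ) % 2 = 1 → f i ∈ B)) := by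
  obtain ⟨x, hx, s, f, hf, hf'⟩ := exists_alt G hG Ct c hc
  generalize XindG G 2 + 2 = t at *
  have hcinj : ∀ i j, i < t → j < t → c (f i) = c (f j) → i = j := by
    intro i j hi hj h
    rcases lt_trichotomy i j with h' | h' | h'
    · exact absurd h (hf' i j h' hj).ne
    · exact h'
    · exact absurd h (hf' j i h' hi).ne'
  have hcard := card_filter_even t
  have hadj : ∀ i j, i < t → j < t → i % 2 = 0 → j % 2 = 1 → G.Adj (f i) (f j) := by
    intro i j hi hj h0 h1
    refine hx.2.2 _ _ ?_ _ (hf i hi) _ (hf j hj)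
    intro h
    have h := add_left_cancel h
    rw [ZMod.natCast_eq_natCast_iff'] at h
    omega
  have hAB : ∀ v ∈ ((Finset.range t).filter (fun i => i % 2 = 0)).image f ∪
      ((Finset.range t).filter (fun i => i % 2 = 1)).image f, ∃ i, i < t ∧ f i = v := by
    intro v hv
    simp only [Finset.mem_union, Finset.mem_image, Finset.mem_filter, Finset.mem_range] at hv
    rcases hv with ⟨i, hi, rfl⟩ | ⟨i, hi, rfl⟩ <;> exact ⟨i, hi.1, rfl⟩
  refine ⟨((Finset.range t).filter (fun i => i % 2 = 0)).image f,
    ((Finset.range t).filter (fun i => i % 2 = 1)).image f, ?_, ?_, ?_, ?_, ?_,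
    fun i => f i, ?_, ?_, ?_⟩
  · rw [Finset.disjoint_left]
    intro v h1 h2
    simp only [Finset.mem_image, Finset.mem_filter, Finset.mem_range] at h1 h2
    obtain ⟨i, ⟨hi, hi'⟩, rfl⟩ := h1
    obtain ⟨j, ⟨hj, hj'⟩, e⟩ := h2
    have := hcinj j i hj hi (by rw [e])
    omega
  · rw [Finset.card_image_of_injOn, hcard.1]
    intro i hi j hj h
    simp only [Finset.coe_filter, Finset.mem_range, Set.mem_ofPred_eq] at hi hj
    exact hcinj i j hi.1 hj.1 (by rw [h])
  · rw [Finset.card_image_of_injOn, hcard.2]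
    intro i hi j hj h
    simp only [Finset.coe_filter, Finset.mem_range, Set.mem_ofPred_eq] at hi hj
    exact hcinj i j hi.1 hj.1 (by rw [h])
  · intro a ha b hb
    simp only [Finset.mem_image, Finset.mem_filter, Finset.mem_range] at ha hb
    obtain ⟨i, ⟨hi, hi'⟩, rfl⟩ := ha
    obtain ⟨j, ⟨hj, hj'⟩, rfl⟩ := hb
    exact hadj i j hi hj hi' hj'
  · intro a ha b hb h
    rw [← Finset.coe_union] at ha hb
    obtain ⟨i, hi, rfl⟩ := hAB a ha
    obtain ⟨j, hj, rfl⟩ := hAB b hb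
    rw [hcinj i j hi hj h]
  · intro i j hij
    exact hf' i j hij j.2
  · intro v hv
    obtain ⟨i, hi, rfl⟩ := hAB v hv
    exact ⟨⟨i, hi⟩, rfl⟩
  · intro i
    constructor
    · intro h
      exact Finset.mem_image_of_mem f (by simp [h])
    · intro h
      exact Finset.mem_image_of_mem f (by simp [h])
end

section
/- (Tucker lemma) Let m and n be positive integers and let λ : {−1, 0, +1}^n ∖ {(0,…,0)} → {±1, ±2, …, ±m} be a map satisfying: (1) λ(−X) = −λ(X) for every X ∈ {−1, 0, +1}^n ∖ {0}; and (2) there are no two vectors X ⊆ Y in {−1, 0, +1}^n ∖ {0} with λ(X) = −λ(Y). Then m ≥ n. -/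
namespace TuckerAux

abbrev Coch := Finset ℤ → ZMod 2

def dl (a : Coch) : Coch := fun S => ∑ x ∈ S, a (S.erase x)

def io (x : ℤ) (a : Coch) : Coch := fun S => if x ∈ S then 0 else a (insert x S)

def nu (a : Coch) : Coch := fun S => a (S.image (fun x => -x))

lemma z2 (a : ZMod 2) : a + a = 0 := CharTwo.add_self_eq_zero a

lemma io_add (x : ℤ) (a b : Coch) : io x (a + b) = io x a + io x b := by
  funext S
  simp only [io, Pi.add_apply]
  split_ifs <;> simp

lemma io_dl (x : ℤ) (a : Coch) : io x (dl a) = a + dl (io x a) := by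
  funext S
  simp only [io, dl, Pi.add_apply]
  split_ifs with h
  · rw [Finset.sum_eq_single x]
    · simp [Finset.insert_erase h, z2]
    · intro b hb hbx
      simp [h, hbx.symm]
    · intro h'; exact absurd h h'
  · rw [Finset.sum_insert h, Finset.erase_insert h]
    congr 1
    apply Finset.sum_congr rfl
    intro y hy
    have hxy : x ≠ y := fun e => h (e ▸ hy)
    rw [if_neg (fun h' => h (Finset.mem_of_mem_erase h')), Finset.erase_insert_of_ne hxy]

lemma sum_pair_zero {ι : Type*} [DecidableEq ι] (S : Finset ι) (f : ι → ι → ZMod 2)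
    (hf : ∀ i j, f i j = f j i) : ∑ i ∈ S, ∑ j ∈ S.erase i, f i j = 0 := by
  rw [Finset.sum_sigma']
  apply Finset.sum_involution (fun (p : (_ : ι) × ι) _ => (⟨p.2, p.1⟩ : (_ : ι) × ι))
  · rintro ⟨i, j⟩ _
    simp only
    rw [hf j i, z2]
  · rintro ⟨i, j⟩ h _ e
    simp at h e
    exact h.2.1 e.1
  · rintro ⟨i, j⟩ h
    simp at h ⊢
    exact ⟨h.2.2, fun e => h.2.1 e.symm, h.1⟩
  · rintro ⟨i, j⟩ _
    rfl

lemma dl_dl (a : Coch) (S : Finset ℤ) : dl (dl a) S = 0 := by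
  simp only [dl]
  exact sum_pair_zero S (fun i j => a ((S.erase i).erase j))
    (fun i j => by rw [Finset.erase_right_comm])

lemma nu_dl (a : Coch) : nu (dl a) = dl (nu a) := by
  funext S
  simp only [nu, dl]
  rw [Finset.sum_image (fun x _ y _ h => neg_injective h)]
  apply Finset.sum_congr rfl
  intro x _
  rw [Finset.image_erase neg_injective]

lemma dl_congr (a b : Coch) (S : Finset ℤ) (h : ∀ x ∈ S, a (S.erase x) = b (S.erase x)) :
    dl a S = dl b S := Finset.sum_congr rfl h

lemma dl_add (a b : Coch) : dl (a + b) = dl a + dl b := by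
  funext S
  simp [dl, Finset.sum_add_distrib]

lemma nu_io (x : ℤ) (a : Coch) : nu (io (-x) a) = io x (nu a) := by
  funext S
  simp [nu, io, Finset.image_insert]

def CF (S : Finset ℤ) : Prop := ∀ s ∈ S, ∀ t ∈ S, s ≠ -t

def PP (S : Finset ℤ) : Prop := ∃ x ∈ S, 0 < x ∧ ∀ y ∈ S, |y| ≤ x

lemma PP_neg (S : Finset ℤ) (hS : CF S) (hne : S.Nonempty) :
    PP (S.image (fun x => -x)) ↔ ¬ PP S := by
  constructor
  · rintro ⟨x, hx, hx0, hxm⟩ ⟨y, hy, hy0, hym⟩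
    obtain ⟨x', hx', rfl⟩ := Finset.mem_image.1 hx
    have h1 := hym x' hx'
    have h2 := hxm (-y) (Finset.mem_image_of_mem _ hy)
    rw [abs_neg, abs_of_pos hy0] at h2
    rw [abs_of_neg (by linarith)] at h1
    exact hS y hy x' hx' (by linarith)
  · intro h
    obtain ⟨x, hx, hm⟩ := Finset.exists_max_image S (fun y => |y|) hne
    have hx0 : x ≠ 0 := by
      rintro rfl
      exact hS 0 hx 0 hx (by simp)
    have hneg : x < 0 := by
      by_contra hc
      have hpos : 0 < x := by omega
      exact h ⟨x, hx, hpos, fun y hy => by simpa [abs_of_pos hpos] using hm y hy⟩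
    refine ⟨-x, Finset.mem_image_of_mem _ hx, by omega, ?_⟩
    intro y hy
    obtain ⟨y', hy', rfl⟩ := Finset.mem_image.1 hy
    simpa [abs_of_neg hneg] using hm y' hy'

open Classical in
noncomputable def half (b : Coch) : Coch := fun S => if PP S then b S else 0

noncomputable def be : ℕ → Coch
  | 0 => dl (fun S => if S = ∅ then 1 else 0)
  | k + 1 => dl (half (be k))

lemma half_zero_of_empty (b : Coch) : half b ∅ = 0 := by
  simp [half, PP]

lemma be_card (k : ℕ) (S : Finset ℤ) (h : be k S ≠ 0) : S.card = k + 1 := by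
  induction k generalizing S with
  | zero =>
    obtain ⟨x, hx, hx'⟩ := Finset.exists_ne_zero_of_sum_ne_zero h
    have : S.erase x = ∅ := by
      by_contra hc
      simp [hc] at hx'
    have h2 := Finset.card_erase_add_one hx
    rw [this] at h2
    simpa using h2.symm
  | succ k ih =>
    obtain ⟨x, hx, hx'⟩ := Finset.exists_ne_zero_of_sum_ne_zero h
    have h3 : be k (S.erase x) ≠ 0 := by
      intro hc
      simp [half, hc] at hx'
    have := ih _ h3
    have h2 := Finset.card_erase_add_one hx
    omega

lemma CF.erase {S : Finset ℤ} (h : CF S) (x : ℤ) : CF (S.erase x) :=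
  fun s hs t ht => h s (Finset.mem_of_mem_erase hs) t (Finset.mem_of_mem_erase ht)

lemma half_add_of_inv (b : Coch) (S : Finset ℤ) (hS : CF S) (h0 : b ∅ = 0)
    (hb : nu b S = b S) : (half b + nu (half b)) S = b S := by
  rcases S.eq_empty_or_nonempty with rfl | hne
  · simp only [Pi.add_apply, nu, Finset.image_empty, half_zero_of_empty, h0, add_zero]
  · have := PP_neg S hS hne
    simp only [nu] at hb
    by_cases hp : PP S <;> simp [half, nu, this, hp, hb]

lemma be_empty (k : ℕ) : be k ∅ = 0 := by
  cases k <;> simp [be, dl]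

lemma dl_be (k : ℕ) (S : Finset ℤ) : dl (be k) S = 0 := by
  cases k <;> exact dl_dl _ _

lemma be_inv (k : ℕ) (S : Finset ℤ) (hS : CF S) : nu (be k) S = be k S := by
  induction k generalizing S with
  | zero =>
    simp only [be]
    rw [nu_dl]
    apply dl_congr
    intro x _
    simp [nu]
  | succ k ih =>
    simp only [be]
    rw [nu_dl]
    have h : dl (half (be k) + nu (half (be k))) S = 0 := by
      rw [← dl_be k S]
      apply dl_congr
      intro x _
      exact half_add_of_inv _ _ (hS.erase x) (be_empty k) (ih _ (hS.erase x))
    rw [dl_add, Pi.add_apply] at h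
    exact (CharTwo.add_eq_zero.1 h).symm

lemma be_split (k : ℕ) (S : Finset ℤ) (hS : CF S) :
    (half (be k) + nu (half (be k))) S = be k S :=
  half_add_of_inv _ _ hS (be_empty k) (be_inv k S hS)

variable {n : ℕ}

def sp (X : Fin n → SignType) : Finset (Fin n) := Finset.univ.filter (fun i => X i ≠ 0)

lemma mem_sp (X : Fin n → SignType) (i : Fin n) : i ∈ sp X ↔ X i ≠ 0 := by simp [sp]

lemma sp_update (X : Fin n → SignType) (i : Fin n) :
    sp (Function.update X i 0) = (sp X).erase i := by
  ext j
  by_cases h : j = i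
  · subst h; simp [mem_sp]
  · simp [mem_sp, h]

def EE (lam : (Fin n → SignType) → ℤ) : ℕ → (Fin n → SignType) → Coch → ZMod 2
  | 0, _, a => a ∅
  | d + 1, X, a => ∑ j ∈ sp X, EE lam d (Function.update X j 0) (io (lam X) a)

variable (lam : (Fin n → SignType) → ℤ)

lemma EE_add (d : ℕ) (X : Fin n → SignType) (a b : Coch) :
    EE lam d X (a + b) = EE lam d X a + EE lam d X b := by
  induction d generalizing X a b with
  | zero => simp [EE]
  | succ d ih => simp [EE, io_add, ih, Finset.sum_add_distrib]

lemma EE_dl_aux (d : ℕ) (X : Fin n → SignType) (a : Coch) :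
    ∑ j ∈ sp X, EE lam d (Function.update X j 0) (dl a) = 0 := by
  induction d generalizing X a with
  | zero => simp [EE, dl]
  | succ d ih =>
    simp only [EE, io_dl, EE_add, Finset.sum_add_distrib, ih, add_zero]
    simp only [sp_update]
    apply sum_pair_zero (sp X)
      (fun i j => EE lam d (Function.update (Function.update X i 0) j 0) a)
    intro i j
    by_cases h : i = j
    · subst h; rfl
    · rw [Function.update_comm h]

lemma EE_dl (d : ℕ) (X : Fin n → SignType) (a : Coch) :
    EE lam (d + 1) X (dl a) = ∑ j ∈ sp X, EE lam d (Function.update X j 0) a := by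
  simp only [EE, io_dl, EE_add, Finset.sum_add_distrib, EE_dl_aux, add_zero]

lemma EE_neg (hodd : ∀ X : Fin n → SignType, (∃ i, X i ≠ 0) →
      lam (fun i => -X i) = -lam X) (d : ℕ) (X : Fin n → SignType) (a : Coch) :
    EE lam d (fun i => -X i) a = EE lam d X (nu a) := by
  induction d generalizing X a with
  | zero => simp [EE, nu]
  | succ d ih =>
    have hs : sp (fun i => -X i) = sp X := by
      ext i; simp [mem_sp]
    simp only [EE, hs]
    apply Finset.sum_congr rfl
    intro j hj
    rw [hodd X ⟨j, (mem_sp _ _).1 hj⟩, ← nu_io, ← ih]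
    congr 1
    funext i
    by_cases h : i = j
    · subst h; simp
    · simp [h]

lemma EE_zero (hne : ∀ X : Fin n → SignType, (∃ i, X i ≠ 0) → lam X ≠ 0)
    (hcomp : ∀ X Y : Fin n → SignType, (∃ i, X i ≠ 0) → (∃ i, Y i ≠ 0) →
      (∀ i, X i ≠ 0 → Y i = X i) → lam X ≠ -lam Y) (d : ℕ) (X : Fin n → SignType) (a : Coch)
    (ha : ∀ S, CF S → (∀ s ∈ S, ∃ Y : Fin n → SignType, (∃ i, Y i ≠ 0) ∧
      (∀ i, Y i ≠ 0 → X i = Y i) ∧ lam Y = s) → a S = 0) :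
    EE lam d X a = 0 := by
  induction d generalizing X a with
  | zero =>
    apply ha <;> simp [CF]
  | succ d ih =>
    simp only [EE]
    apply Finset.sum_eq_zero
    intro j hj
    have hX : ∃ i, X i ≠ 0 := ⟨j, (mem_sp _ _).1 hj⟩
    apply ih
    intro S hS hl
    have hl' : ∀ s ∈ S, ∃ Y : Fin n → SignType, (∃ i, Y i ≠ 0) ∧
      (∀ i, Y i ≠ 0 → X i = Y i) ∧ lam Y = s := by
      intro s hs
      obtain ⟨Y, h1, h2, h3⟩ := hl s hs
      refine ⟨Y, h1, ?_, h3⟩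
      intro i hi
      have := h2 i hi
      by_cases h : i = j
      · subst h; simp at this; exact absurd this.symm hi
      · simpa [h] using this
    have hx : ∀ s ∈ S, s ≠ - lam X := by
      intro s hs
      obtain ⟨Y, h1, h2, rfl⟩ := hl' s hs
      exact hcomp Y X h1 hX h2
    simp only [io]
    split_ifs with h
    · rfl
    · apply ha
      · intro s hs t ht
        rcases Finset.mem_insert.1 hs with rfl | hs
        · rcases Finset.mem_insert.1 ht with rfl | ht
          · have := hne X hX
            omega
          · have := hx t ht
            omega
        · rcases Finset.mem_insert.1 ht with rfl | ht
          · exact hx s hs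
          · exact hS s hs t ht
      · intro s hs
        rcases Finset.mem_insert.1 hs with rfl | hs
        · exact ⟨X, hX, fun _ _ => rfl, rfl⟩
        · exact hl' s hs

def FS (n k : ℕ) : Finset (Fin n → SignType) :=
  Finset.univ.filter (fun X => ∀ i, X i ≠ 0 ↔ i.val < k)

def GS (k : Fin n) : Finset (Fin n → SignType) :=
  Finset.univ.filter (fun X => (∀ i, X i ≠ 0 ↔ i.val < k.val + 1) ∧ X k = 1)

lemma GS_sum (k : Fin n) (f : (Fin n → SignType) → ZMod 2) :
    ∑ X ∈ GS k, ∑ j ∈ sp X, f (Function.update X j 0) = ∑ X ∈ FS n k.val, f X := by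
  have h1 : ∀ X ∈ GS k, ∑ j ∈ sp X, f (Function.update X j 0) =
      ∑ j ∈ Finset.univ.filter (fun i : Fin n => i.val < k.val + 1), f (Function.update X j 0) := by
    intro X hX
    have : sp X = Finset.univ.filter (fun i : Fin n => i.val < k.val + 1) := by
      ext i
      simp only [GS, Finset.mem_filter, Finset.mem_univ, true_and] at hX
      simp only [mem_sp, hX.1 i, Finset.mem_filter, Finset.mem_univ, true_and]
    rw [this]
  rw [Finset.sum_congr rfl h1, Finset.sum_comm, Finset.sum_eq_single k]
  · refine Finset.sum_bij' (fun X _ => Function.update X k 0) (fun X _ => Function.update X k 1) ?_ ?_ ?_ ?_ ?_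
    · intro X hX
      simp only [GS, FS, Finset.mem_filter, Finset.mem_univ, true_and] at hX ⊢
      intro i
      by_cases h : i = k
      · subst h; simp
      · have h' : i.val ≠ k.val := fun e => h (Fin.ext e)
        simp only [Function.update_of_ne h, hX.1 i]
        omega
    · intro X hX
      simp only [GS, FS, Finset.mem_filter, Finset.mem_univ, true_and] at hX ⊢
      refine ⟨?_, by simp⟩
      intro i
      by_cases h : i = k
      · subst h; simp
      · have h' : i.val ≠ k.val := fun e => h (Fin.ext e)
        simp only [Function.update_of_ne h, hX i]
        omega
    · intro X hX
      simp only [GS, Finset.mem_filter, Finset.mem_univ, true_and] at hX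
      simp [← hX.2]
    · intro X hX
      simp only [FS, Finset.mem_filter, Finset.mem_univ, true_and] at hX
      have : X k = 0 := by
        by_contra hc
        have := (hX k).1 hc
        omega
      simp [← this]
    · intro X hX
      rfl
  · intro j hj hjk
    simp only [Finset.mem_filter, Finset.mem_univ, true_and] at hj
    refine Finset.sum_involution (fun X _ => Function.update X j (-X j)) ?_ ?_ ?_ ?_
    · intro X hX
      simp [z2]
    · intro X hX _ e
      simp only [GS, Finset.mem_filter, Finset.mem_univ, true_and] at hX
      have h0 := (hX.1 j).2 hj
      have := congrFun e j
      simp only [Function.update_self] at this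
      revert this h0
      generalize X j = s
      revert s
      decide
    · intro X hX
      simp only [GS, Finset.mem_filter, Finset.mem_univ, true_and] at hX ⊢
      refine ⟨?_, by simp [hjk.symm, hX.2]⟩
      intro i
      rw [← hX.1 i]
      by_cases h : i = j
      · subst h; simp
      · simp [h]
    · intro X hX
      simp
  · intro h
    simp at h

lemma FS_sum (k : Fin n) (f : (Fin n → SignType) → ZMod 2) :
    ∑ X ∈ FS n (k.val + 1), f X = ∑ X ∈ GS k, (f X + f (fun i => -X i)) := by
  rw [Finset.sum_add_distrib, ← Finset.sum_filter_add_sum_filter_not _ (fun X => X k = 1)]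
  congr 1
  · apply Finset.sum_congr _ (fun _ _ => rfl)
    ext X
    simp [FS, GS]
  · have hs : ∀ s : SignType, s ≠ 0 → s ≠ 1 → -s = 1 := by decide
    refine Finset.sum_bij' (fun X _ => fun i => -X i) (fun X _ => fun i => -X i) ?_ ?_ ?_ ?_ ?_
    · intro X hX
      simp only [GS, FS, Finset.mem_filter, Finset.mem_univ, true_and] at hX ⊢
      refine ⟨fun i => by rw [← hX.1 i]; simp, ?_⟩
      exact hs _ ((hX.1 k).2 (by omega)) hX.2
    · intro X hX
      simp only [GS, FS, Finset.mem_filter, Finset.mem_univ, true_and] at hX ⊢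
      refine ⟨fun i => by rw [← hX.1 i]; simp, ?_⟩
      rw [hX.2]; decide
    · intro X _; simp
    · intro X _; simp
    · intro X _; simp

end TuckerAux


/-- **Tucker lemma:** if `λ : {−1, 0, +1}^n ∖ {0} → {±1, …, ±m}` satisfies
`λ(−X) = −λ(X)` and there is no pair `X ⊆ Y` with `λ(X) = −λ(Y)`, then `m ≥ n`.
(Vectors are maps `Fin n → SignType`; `X ⊆ Y` means `Y` agrees with `X` on every
nonzero coordinate of `X`.) -/
theorem tucker_lemma (m n : ℕ) (hm : 1 ≤ m) (hn : 1 ≤ n)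
    (lam : (Fin n → SignType) → ℤ)
    (hrange : ∀ X : Fin n → SignType, (∃ i, X i ≠ 0) → 1 ≤ |lam X| ∧ |lam X| ≤ m)
    (hodd : ∀ X : Fin n → SignType, (∃ i, X i ≠ 0) →
      lam (fun i => -X i) = -lam X)
    (hcomp : ∀ X Y : Fin n → SignType, (∃ i, X i ≠ 0) → (∃ i, Y i ≠ 0) →
      (∀ i, X i ≠ 0 → Y i = X i) → lam X ≠ -lam Y) :
    n ≤ m := by
  classical
  have hne : ∀ X : Fin n → SignType, (∃ i, X i ≠ 0) → lam X ≠ 0 := by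
    intro X hX h
    have := (hrange X hX).1
    simp [h] at this
  have key : ∀ k : ℕ, ∀ hk : k < n,
      ∑ X ∈ TuckerAux.GS (⟨k, hk⟩ : Fin n), TuckerAux.EE lam (k + 1) X (TuckerAux.be k) = 1 := by
    intro k
    induction k with
    | zero =>
      intro hk
      simp only [TuckerAux.be, TuckerAux.EE_dl]
      rw [TuckerAux.GS_sum ⟨0, hk⟩ (fun Y => TuckerAux.EE lam 0 Y _)]
      have : TuckerAux.FS n 0 = {fun _ => 0} := by
        ext X
        simp [TuckerAux.FS, funext_iff]
      simp [this, TuckerAux.EE]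
    | succ k ih =>
      intro hk
      have hk' : k < n := by omega
      rw [← ih hk']
      simp only [TuckerAux.be]
      simp only [TuckerAux.EE_dl lam (k + 1)]
      rw [TuckerAux.GS_sum ⟨k + 1, hk⟩
        (fun Y => TuckerAux.EE lam (k + 1) Y (TuckerAux.half (TuckerAux.be k)))]
      rw [TuckerAux.FS_sum ⟨k, hk'⟩
        (fun Y => TuckerAux.EE lam (k + 1) Y (TuckerAux.half (TuckerAux.be k)))]
      apply Finset.sum_congr rfl
      intro X _
      rw [TuckerAux.EE_neg lam hodd, ← TuckerAux.EE_add]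
      apply CharTwo.add_eq_zero.1
      rw [← TuckerAux.EE_add]
      apply TuckerAux.EE_zero lam hne hcomp
      intro S hS _
      rw [Pi.add_apply, TuckerAux.be_split k S hS, TuckerAux.z2]
  by_contra hlt
  have hlast := key (n - 1) (by omega)
  rw [Finset.sum_eq_zero] at hlast
  · exact absurd hlast (by decide)
  intro X _
  apply TuckerAux.EE_zero lam hne hcomp
  intro S hS hl
  by_contra hc
  have hcard := TuckerAux.be_card _ _ hc
  have hle : S.card ≤ (Finset.Icc 1 m).card := by
    apply Finset.card_le_card_of_injOn Int.natAbs
    · intro s hs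
      obtain ⟨Y, hY, _, rfl⟩ := hl s hs
      have := hrange Y hY
      rw [Int.abs_eq_natAbs] at this
      simp only [Finset.coe_Icc, Set.mem_Icc]
      omega
    · intro s hs t ht hst
      rcases Int.natAbs_eq_natAbs_iff.1 hst with h | h
      · exact h
      · exact absurd h (hS s hs t ht)
  simp at hle
  omega
end

section
/- (Ky Fan lemma) Let m and n be positive integers and let λ : {−1, 0, +1}^n ∖ {(0,…,0)} → {±1, ±2, …, ±m} be a map satisfying: (1) λ(−X) = −λ(X) for every X ∈ {−1, 0, +1}^n ∖ {0}; and (2) there are no two vectors X ⊆ Y in {−1, 0, +1}^n ∖ {0} with λ(X) = −λ(Y). Then the number of chains X_1 ⊆ X_2 ⊆ ⋯ ⊆ X_n in {−1, 0, +1}^n ∖ {0} such that {λ(X_1), …, λ(X_n)} = {+c_1, −c_2, +c_3, …, (−1)^{n−1} c_n} for some integers 1 ≤ c_1 < c_2 < ⋯ < c_n ≤ m is odd; in particular, at least one such chain exists and m ≥ n. -/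
/-- The set of chains `Z 0 ⊆ Z 1 ⊆ ⋯ ⊆ Z (n-1)` of nonzero vectors in
`{−1, 0, +1}^n` whose set of labels `{λ(Z 0), …, λ(Z (n-1))}` equals
`{+c_1, −c_2, +c_3, …, (−1)^{n−1} c_n}` for some `1 ≤ c_1 < c_2 < ⋯ < c_n ≤ m`. -/
def kyFanChains (m n : ℕ) (lam : (Fin n → SignType) → ℤ) :
    Set (Fin n → (Fin n → SignType)) :=
  {Z | (∀ k : Fin n, ∃ i, Z k i ≠ 0) ∧
    (∀ (k : ℕ) (h : k + 1 < n), ∀ i,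
      Z ⟨k, by omega⟩ i ≠ 0 → Z ⟨k + 1, h⟩ i = Z ⟨k, by omega⟩ i) ∧
    ∃ c : Fin n → ℤ, StrictMono c ∧ (∀ k, 1 ≤ c k ∧ c k ≤ m) ∧
      Set.range (fun k => lam (Z k)) =
        Set.range (fun k : Fin n => (-1) ^ (k : ℕ) * c k)}

namespace KF

open Finset

/-- alternating sets -/
def Alt (ε : ℤ) (S : Finset ℤ) : Prop :=
  ∃ (k : ℕ) (c : Fin k → ℤ), StrictMono c ∧ (∀ j, 1 ≤ c j) ∧
    (S : Set ℤ) = Set.range (fun j : Fin k => ε * (-1) ^ (j : ℕ) * c j)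

lemma abs_term (ε : ℤ) (hε : ε = 1 ∨ ε = -1) (j : ℕ) (x : ℤ) (hx : 1 ≤ x) :
    |ε * (-1) ^ j * x| = x := by
  rw [abs_mul, abs_mul, abs_pow]
  rcases hε with rfl | rfl <;> simp <;> omega

lemma alt_empty (ε : ℤ) : Alt ε ∅ :=
  ⟨0, Fin.elim0, fun a => a.elim0, fun a => a.elim0, by simp⟩

lemma alt_insert (ε : ℤ) (hε : ε = 1 ∨ ε = -1) (a : ℤ) (S : Finset ℤ)
    (h : ∀ x ∈ S, |a| < |x|) :
    Alt ε (insert a S) ↔ 0 < ε * a ∧ Alt (-ε) S := by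
  constructor
  · rintro ⟨k, c, hc, h1, hS⟩
    cases k with
    | zero =>
      have : a ∈ ((insert a S : Finset ℤ) : Set ℤ) := by simp
      rw [hS] at this
      obtain ⟨j, _⟩ := this
      exact j.elim0
    | succ k =>
      have h0 : ε * c 0 ∈ ((insert a S : Finset ℤ) : Set ℤ) := by
        rw [hS]; exact ⟨0, by simp⟩
      have ha : a ∈ ((insert a S : Finset ℤ) : Set ℤ) := by simp
      have ha' := ha
      rw [hS] at ha'
      obtain ⟨j, hj⟩ := ha'
      have habs : |a| = c j := by rw [← hj]; exact abs_term ε hε _ _ (h1 j)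
      have h0abs : |ε * c 0| = c 0 := by simpa using abs_term ε hε 0 _ (h1 0)
      have hle : c 0 ≤ c j := hc.monotone (Fin.zero_le j)
      have hae : a = ε * c 0 := by
        simp only [coe_insert, Set.mem_insert_iff, mem_coe] at h0
        rcases h0 with h0 | h0
        · exact h0.symm
        · have := h _ h0
          omega
      have haS : a ∉ S := fun hh => lt_irrefl _ (h a hh)
      refine ⟨?_, k, fun j => c j.succ, fun x y hxy => hc (Fin.succ_lt_succ_iff.2 hxy),
        fun j => h1 _, ?_⟩
      · have := h1 0
        rw [hae]
        rcases hε with rfl | rfl <;> simp <;> omega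
      · ext x
        constructor
        · intro hx
          have hx' : x ∈ ((insert a S : Finset ℤ) : Set ℤ) := by
            simp only [coe_insert, Set.mem_insert_iff]; right; exact hx
          rw [hS] at hx'
          obtain ⟨i, hi⟩ := hx'
          rcases Fin.eq_zero_or_eq_succ i with rfl | ⟨i, rfl⟩
          · exfalso; apply haS
            rw [hae]; convert hx using 1
            rw [← hi]; simp
          · refine ⟨i, ?_⟩
            rw [← hi]; simp [pow_succ]
        · rintro ⟨i, hi⟩
          have hx' : x ∈ ((insert a S : Finset ℤ) : Set ℤ) := by
            rw [hS]; refine ⟨i.succ, ?_⟩; rw [← hi]; simp [pow_succ]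
          simp only [coe_insert, Set.mem_insert_iff] at hx'
          rcases hx' with hx' | hx'
          · exfalso
            have e1 : |x| = c i.succ := by
              rw [← hi]; exact abs_term (-ε) (by omega) _ _ (h1 _)
            have : c 0 < c i.succ := hc (Fin.succ_pos i)
            rw [hx', hae, h0abs] at e1
            omega
          · exact hx'
  · rintro ⟨ha, k, c, hc, h1, hS⟩
    have haa : |a| = ε * a := by
      rcases hε with rfl | rfl
      · rw [one_mul] at *; exact abs_of_pos ha
      · rw [neg_one_mul] at *; exact abs_of_neg (by omega)
    refine ⟨k + 1, Fin.cons (ε * a) c, ?_, ?_, ?_⟩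
    · intro x y hxy
      rcases Fin.eq_zero_or_eq_succ y with rfl | ⟨y, rfl⟩
      · exact absurd hxy (Fin.not_lt_zero x)
      rcases Fin.eq_zero_or_eq_succ x with rfl | ⟨x, rfl⟩
      · have hm : (-ε) * (-1) ^ (y : ℕ) * c y ∈ S := by
          rw [← mem_coe, hS]; exact ⟨y, rfl⟩
        have := h _ hm
        rw [abs_term (-ε) (by omega) _ _ (h1 y), haa] at this
        simpa using this
      · simpa using hc (Fin.succ_lt_succ_iff.1 hxy)
    · intro j
      rcases Fin.eq_zero_or_eq_succ j with rfl | ⟨j, rfl⟩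
      · simp only [Fin.cons_zero]; omega
      · simpa using h1 j
    · rw [coe_insert, hS]
      ext x
      simp only [Set.mem_insert_iff, Set.mem_range]
      rw [Fin.exists_fin_succ]
      apply or_congr
      · have : ε * (ε * a) = a := by rcases hε with rfl | rfl <;> simp
        simp [this, eq_comm]
      · simp [pow_succ]

open Classical in
/-- indicator -/
noncomputable def ind (p : Prop) : ZMod 2 := if p then 1 else 0

lemma zmod2_add_self (x : ZMod 2) : x + x = 0 := CharTwo.add_self_eq_zero x

lemma key_finset (S : Finset ℤ) (hS : ∀ x ∈ S, ∀ y ∈ S, x ≠ -y) :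
    ∀ ε : ℤ, (ε = 1 ∨ ε = -1) →
    ∑ b ∈ S, ind (Alt ε (S.erase b)) = ind (Alt ε S) + ind (Alt (-ε) S) := by
  induction S using Finset.induction_on_min_value (fun x : ℤ => |x|) with
  | empty => intro ε hε; simp [ind, alt_empty]; decide
  | insert a S haS hmin ih =>
    intro ε hε
    have hlt : ∀ x ∈ S, |a| < |x| := by
      intro x hx
      refine lt_of_le_of_ne (hmin x hx) ?_
      intro he
      rcases abs_eq_abs.1 he with h | h
      · exact haS (h ▸ hx)
      · exact hS a (by simp) x (by simp [hx]) h
    have ih' := ih (fun x hx y hy => hS x (by simp [hx]) y (by simp [hy])) (-ε) (by omega)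
    rw [Finset.sum_insert haS, Finset.erase_insert haS, alt_insert ε hε a S hlt,
      alt_insert (-ε) (by omega) a S hlt]
    have ha0 : a ≠ 0 := by
      intro h; exact hS a (by simp) a (by simp) (by omega)
    have hsum : ∑ b ∈ S, ind (Alt ε ((insert a S).erase b)) =
        ∑ b ∈ S, ind (0 < ε * a ∧ Alt (-ε) (S.erase b)) := by
      apply Finset.sum_congr rfl
      intro b hb
      have : a ≠ b := by rintro rfl; exact haS hb
      rw [Finset.erase_insert_of_ne this, alt_insert ε hε]
      intro x hx
      exact hlt x (Finset.mem_of_mem_erase hx)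
    rw [hsum]
    by_cases hp : 0 < ε * a
    · have hn : ¬ 0 < -ε * a := by rw [neg_mul]; omega
      simp only [hp, hn, true_and, false_and]
      rw [ih', neg_neg]
      have := zmod2_add_self (ind (Alt ε S))
      have hf : ind False = 0 := by simp [ind]
      rw [hf]
      linear_combination this
    · have hn : 0 < -ε * a := by
        rw [neg_mul]
        have : ε * a ≠ 0 := mul_ne_zero (by omega) ha0
        omega
      have hf : ind False = 0 := by simp [ind]
      simp only [hp, hn, true_and, false_and, neg_neg, hf, Finset.sum_const_zero]
      ring

/-- alternating families -/
def PAlt {n : ℕ} (ε : ℤ) (v : Fin n → ℤ) : Prop :=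
  Function.Injective v ∧ Alt ε (univ.image v)

lemma palt_neg {n : ℕ} (v : Fin n → ℤ) : PAlt 1 (fun k => - v k) ↔ PAlt (-1) v := by
  unfold PAlt
  apply and_congr
  · exact neg_injective.of_comp_iff v
  · unfold Alt
    refine exists_congr fun k => exists_congr fun c => and_congr Iff.rfl (and_congr Iff.rfl ?_)
    simp only [coe_image, coe_univ, Set.image_univ]
    rw [Set.ext_iff, Set.ext_iff, ← (Equiv.neg ℤ).forall_congr_right]
    refine forall_congr' fun x => ?_
    simp [neg_eq_iff_eq_neg]

lemma palt_iff {n : ℕ} (v : Fin n → ℤ) : PAlt 1 v ↔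
    ∃ c : Fin n → ℤ, StrictMono c ∧ (∀ k, 1 ≤ c k) ∧
      Set.range v = Set.range (fun k : Fin n => (-1) ^ (k : ℕ) * c k) := by
  have inj : ∀ (k : ℕ) (c : Fin k → ℤ), StrictMono c → (∀ j, 1 ≤ c j) →
      Function.Injective (fun j : Fin k => (-1) ^ (j : ℕ) * c j) := by
    intro k c hc h1 i j hij
    apply hc.injective
    have e := abs_term 1 (by simp) i (c i) (h1 i)
    have e' := abs_term 1 (by simp) j (c j) (h1 j)
    simp only [one_mul] at e e'
    simp only at hij
    rw [← e, ← e', hij]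
  constructor
  · rintro ⟨hv, k, c, hc, h1, hS⟩
    simp only [coe_image, coe_univ, Set.image_univ, one_mul] at hS
    have : n = k := by
      have a1 := Set.ncard_range_of_injective hv
      have a2 := Set.ncard_range_of_injective (inj k c hc h1)
      rw [hS, a2] at a1
      simpa using a1.symm
    subst this
    exact ⟨c, hc, h1, hS⟩
  · rintro ⟨c, hc, h1, hS⟩
    refine ⟨?_, n, c, hc, h1, by simpa using hS⟩
    have hcard : (univ.image v).card = (univ : Finset (Fin n)).card := by
      have a2 := Set.ncard_range_of_injective (inj n c hc h1)
      rw [← hS] at a2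
      rw [← Set.ncard_coe_finset]
      simpa using a2
    have := Finset.card_image_iff.1 hcard
    simpa using this

lemma key {n : ℕ} (v : Fin (n + 1) → ℤ) (hv : ∀ i j, v i ≠ - v j) :
    ∑ i : Fin (n + 1), ind (PAlt 1 (fun k => v (i.succAbove k))) = ind (PAlt 1 v) + ind (PAlt (-1) v) := by
  by_cases hinj : Function.Injective v
  · have hk := key_finset (univ.image v) (by
      intro x hx y hy
      simp only [mem_image, mem_univ, true_and] at hx hy
      obtain ⟨i, rfl⟩ := hx
      obtain ⟨j, rfl⟩ := hy
      exact hv i j) 1 (by simp)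
    rw [Finset.sum_image (fun x _ y _ h => hinj h)] at hk
    unfold PAlt
    simp only [hinj, true_and]
    rw [← hk]
    apply Finset.sum_congr rfl
    intro i _
    congr 1
    have h1 : Function.Injective (fun k => v (i.succAbove k)) :=
      hinj.comp Fin.succAbove_right_injective
    have h2 : univ.image (fun k => v (i.succAbove k)) = (univ.image v).erase (v i) := by
      ext x
      simp only [mem_image, mem_univ, true_and, mem_erase]
      constructor
      · rintro ⟨k, rfl⟩
        exact ⟨fun h => Fin.succAbove_ne i k (hinj h), _, rfl⟩
      · rintro ⟨hx, j, rfl⟩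
        have : j ≠ i := by rintro rfl; exact hx rfl
        obtain ⟨k, rfl⟩ := Fin.exists_succAbove_eq this
        exact ⟨k, rfl⟩
    simp only [h1, true_and, h2]
  · have hr : ind (PAlt 1 v) + ind (PAlt (-1) v) = 0 := by
      simp [PAlt, hinj, ind]
    rw [hr]
    simp only [Function.Injective, not_forall] at hinj
    obtain ⟨i, j, hij, hne⟩ := hinj
    have hz : ∀ l : Fin (n + 1), l ≠ i → l ≠ j → ind (PAlt 1 (fun k => v (l.succAbove k))) = 0 := by
      intro l hli hlj
      have : ¬ PAlt 1 (fun k => v (l.succAbove k)) := by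
        rintro ⟨h, _⟩
        obtain ⟨a, rfl⟩ := Fin.exists_succAbove_eq hli.symm
        obtain ⟨b, rfl⟩ := Fin.exists_succAbove_eq hlj.symm
        exact hne (congrArg _ (h hij))
      simp [ind, this]
    have hsub : ∑ l : Fin (n + 1), ind (PAlt 1 (fun k => v (l.succAbove k))) =
        ∑ l ∈ ({i, j} : Finset (Fin (n + 1))), ind (PAlt 1 (fun k => v (l.succAbove k))) := by
      symm
      apply Finset.sum_subset (Finset.subset_univ _)
      intro l _ hl
      simp only [mem_insert, mem_singleton, not_or] at hl
      exact hz l hl.1 hl.2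
    rw [hsub, Finset.sum_pair hne]
    have hrg : ∀ a b : Fin (n + 1), a ≠ b → v a = v b →
        Set.range (fun k => v (a.succAbove k)) ⊆ Set.range (fun k => v (b.succAbove k)) := by
      rintro a b hab he _ ⟨k, rfl⟩
      by_cases h : a.succAbove k = b
      · obtain ⟨l, hl⟩ := Fin.exists_succAbove_eq hab
        exact ⟨l, by simp only [hl, h, he]⟩
      · obtain ⟨l, hl⟩ := Fin.exists_succAbove_eq h
        exact ⟨l, by simp only [hl]⟩
    have : PAlt 1 (fun k => v (i.succAbove k)) ↔ PAlt 1 (fun k => v (j.succAbove k)) := by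
      rw [palt_iff, palt_iff, (hrg i j hne hij).antisymm (hrg j i (Ne.symm hne) hij.symm)]
    rw [this]
    exact zmod2_add_self _

/-- sign -/
def sg (b : Bool) : SignType := if b then 1 else -1

/-- flag to chain -/
def chain {n : ℕ} (p : Equiv.Perm (Fin n) × (Fin n → Bool)) (k : Fin n) : Fin n → SignType :=
  fun j => if p.1 j ≤ k then sg (p.2 j) else 0

lemma sg_ne (b : Bool) : sg b ≠ 0 := by cases b <;> decide

lemma chain_ne {n : ℕ} (p : Equiv.Perm (Fin n) × (Fin n → Bool)) (k j : Fin n) :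
    chain p k j ≠ 0 ↔ p.1 j ≤ k := by
  unfold chain
  split_ifs with h <;> simp [h, sg_ne]

lemma chain_nz {n : ℕ} (p : Equiv.Perm (Fin n) × (Fin n → Bool)) (k : Fin n) :
    ∃ i, chain p k i ≠ 0 := ⟨p.1.symm k, by rw [chain_ne]; simp⟩

lemma chain_le {n : ℕ} (p : Equiv.Perm (Fin n) × (Fin n → Bool)) (k l : Fin n) (h : k ≤ l)
    (i : Fin n) (hi : chain p k i ≠ 0) : chain p l i = chain p k i := by
  rw [chain_ne] at hi
  simp [chain, hi, hi.trans h]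

/-- good labelling -/
def Good {n : ℕ} (lam : (Fin n → SignType) → ℤ) : Prop :=
    (∀ X : Fin n → SignType, (∃ i, X i ≠ 0) →
      lam (fun i => -X i) = -lam X) ∧
    (∀ X Y : Fin n → SignType, (∃ i, X i ≠ 0) → (∃ i, Y i ≠ 0) →
      (∀ i, X i ≠ 0 → Y i = X i) → lam X ≠ -lam Y)

lemma good_chain {n : ℕ} {lam : (Fin n → SignType) → ℤ} (h : Good lam)
    (p : Equiv.Perm (Fin n) × (Fin n → Bool)) (i j : Fin n) :
    lam (chain p i) ≠ - lam (chain p j) := by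
  rcases le_total i j with hij | hij
  · exact h.2 _ _ (chain_nz p i) (chain_nz p j) (chain_le p i j hij)
  · have := h.2 _ _ (chain_nz p j) (chain_nz p i) (chain_le p j i hij)
    omega

/-- summand -/
noncomputable def W {n : ℕ} (lam : (Fin n → SignType) → ℤ)
    (p : Equiv.Perm (Fin n) × (Fin n → Bool)) : ZMod 2 :=
  ind (PAlt 1 (fun k => lam (chain p k)))

/-- flip all signs -/
def flip {n : ℕ} (p : Equiv.Perm (Fin n) × (Fin n → Bool)) :
    Equiv.Perm (Fin n) × (Fin n → Bool) := (p.1, fun j => !(p.2 j))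

lemma chain_flip {n : ℕ} (p : Equiv.Perm (Fin n) × (Fin n → Bool)) (k : Fin n) :
    chain (flip p) k = fun i => - chain p k i := by
  ext1 i
  simp only [chain, flip]
  by_cases h : p.1 i ≤ k
  · cases p.2 i <;> simp [sg, h]
  · simp [h]

lemma sum_half {n : ℕ} {lam : (Fin (n + 1) → SignType) → ℤ} (h : Good lam) :
    ∑ p, W lam p = ∑ p with p.2 (Fin.last n) = true,
      ∑ i : Fin (n + 1), ind (PAlt 1 (fun k => lam (chain p (i.succAbove k)))) := by
  rw [← Finset.sum_filter_add_sum_filter_not univ (fun p => p.2 (Fin.last n) = true)]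
  have : ∑ p with ¬ p.2 (Fin.last n) = true, W lam p =
      ∑ p with p.2 (Fin.last n) = true, W lam (flip p) := by
    apply Finset.sum_nbij' flip flip
    · intro p hp; simpa [flip] using hp
    · intro p hp; simpa [flip] using hp
    · intro p hp; simp [flip]
    · intro p hp; simp [flip]
    · intro p hp; simp [flip]
  rw [this, ← Finset.sum_add_distrib]
  apply Finset.sum_congr rfl
  intro p _
  rw [key (fun k => lam (chain p k)) (fun i j => good_chain h p i j), W, W, ← palt_neg]
  congr 4
  ext k
  rw [chain_flip, h.1 _ (chain_nz p k)]

lemma sum_mid {n : ℕ} (lam : (Fin (n + 1) → SignType) → ℤ) (i : Fin n) :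
    ∑ p with p.2 (Fin.last n) = true,
      ind (PAlt 1 (fun k => lam (chain p (i.castSucc.succAbove k)))) = 0 := by
  have hne : i.castSucc ≠ i.succ := (Fin.castSucc_lt_succ (i := i)).ne
  apply Finset.sum_involution (fun p _ => (Equiv.swap i.castSucc i.succ * p.1, p.2))
  · intro p _
    convert zmod2_add_self _ using 4
    ext k
    congr 1
    ext1 j
    simp only [chain, Equiv.Perm.mul_apply]
    congr 1
    have hk : i.castSucc.succAbove k ≠ i.castSucc := Fin.succAbove_ne _ _
    generalize i.castSucc.succAbove k = l at hk
    rw [Equiv.swap_apply_def]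
    simp only [Fin.le_def, Fin.ext_iff, Fin.val_castSucc, Fin.val_succ, ne_eq] at *
    split_ifs <;> simp only [Fin.val_castSucc, Fin.val_succ, eq_iff_iff] <;> omega
  · intro p _ _ he
    have h1 := congrArg (fun q => q.1 (p.1.symm i.castSucc)) he
    simp at h1
    exact hne h1.symm
  · intro p hp; simpa using hp
  · intro p hp; simp [← mul_assoc]

lemma sum_last_bad {n : ℕ} (lam : (Fin (n + 1) → SignType) → ℤ) :
    ∑ p with p.2 (Fin.last n) = true ∧ ¬ p.1 (Fin.last n) = Fin.last n,
      ind (PAlt 1 (fun k : Fin n => lam (chain p k.castSucc))) = 0 := by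
  apply Finset.sum_involution (fun p _ => (p.1,
    Function.update p.2 (p.1.symm (Fin.last n)) (!(p.2 (p.1.symm (Fin.last n))))))
  · intro p _
    convert zmod2_add_self _ using 4
    ext k
    congr 1
    ext1 j
    simp only [chain]
    split_ifs with hj
    · rw [Function.update_of_ne]
      rintro rfl
      simp only [Equiv.apply_symm_apply] at hj
      exact absurd (Fin.castSucc_lt_last k) (not_lt.2 hj)
    · rfl
  · intro p _ _ he
    have h1 := congrArg (fun q => q.2 (p.1.symm (Fin.last n))) he
    simp at h1
  · intro p hp; simp
  · intro p hp
    simp only [mem_filter, mem_univ, true_and] at hp ⊢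
    refine ⟨?_, hp.2⟩
    rw [Function.update_of_ne]
    · exact hp.1
    · intro h
      apply hp.2
      rw [Equiv.eq_symm_apply] at h
      exact h

/-- extend a permutation by fixing last -/
def ext {n : ℕ} (r : Equiv.Perm (Fin n)) : Equiv.Perm (Fin (n + 1)) :=
  (finSuccEquivLast.symm.permCongr) r.optionCongr

lemma ext_last {n : ℕ} (r : Equiv.Perm (Fin n)) : ext r (Fin.last n) = Fin.last n := by
  simp [ext, Equiv.permCongr_apply]

lemma ext_castSucc {n : ℕ} (r : Equiv.Perm (Fin n)) (j : Fin n) :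
    ext r j.castSucc = (r j).castSucc := by
  simp [ext, Equiv.permCongr_apply]

lemma sum_last_good {n : ℕ} (lam : (Fin (n + 1) → SignType) → ℤ) :
    ∑ p with p.2 (Fin.last n) = true ∧ p.1 (Fin.last n) = Fin.last n,
      ind (PAlt 1 (fun k : Fin n => lam (chain p k.castSucc))) =
    ∑ p, W (fun Y : Fin n → SignType => lam (Fin.snoc (α := fun _ => SignType) Y 0)) p := by
  symm
  apply Finset.sum_bij (fun p _ => (ext p.1, Fin.snoc (α := fun _ => Bool) p.2 true))
  · intro p _
    simp [ext_last]
  · rintro ⟨r, s⟩ _ ⟨r', s'⟩ _ he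
    simp only [Prod.mk.injEq] at he
    obtain ⟨h1, h2⟩ := he
    congr 1
    · ext1 j
      have := congrArg (fun q => q j.castSucc) h1
      simpa [ext_castSucc] using this
    · ext1 j
      have := congrFun h2 j.castSucc
      simpa using this
  · rintro ⟨r, s⟩ hp
    simp only [mem_filter, mem_univ, true_and] at hp
    obtain ⟨hs, hr⟩ := hp
    have hnl : ∀ j : Fin n, r j.castSucc ≠ Fin.last n := by
      intro j hj
      rw [← hr] at hj
      exact (Fin.castSucc_lt_last j).ne (r.injective hj)
    have hb : Function.Bijective (fun j : Fin n => (r j.castSucc).castPred (hnl j)) := by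
      apply Function.Injective.bijective_of_finite
      intro a b hab
      simpa using hab
    refine ⟨(Equiv.ofBijective _ hb, fun j => s j.castSucc), mem_univ _, ?_⟩
    congr 1
    · ext1 j
      refine Fin.lastCases ?_ (fun j => ?_) j
      · rw [ext_last, hr]
      · rw [ext_castSucc]; simp
    · ext1 j
      refine Fin.lastCases ?_ (fun j => ?_) j
      · simp [hs]
      · simp
  · intro p _
    unfold W
    congr 2
    ext k
    refine congrArg lam ?_
    ext1 j
    refine Fin.lastCases ?_ (fun j => ?_) j
    · have : ¬ Fin.last n ≤ k.castSucc := not_le.2 (Fin.castSucc_lt_last k)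
      simp [chain, ext_last, this]
    · simp [chain, ext_castSucc]

lemma good_restrict {n : ℕ} {lam : (Fin (n + 1) → SignType) → ℤ} (h : Good lam) :
    Good (fun Y : Fin n → SignType => lam (Fin.snoc (α := fun _ => SignType) Y 0)) := by
  have nz : ∀ X : Fin n → SignType, (∃ i, X i ≠ 0) →
      ∃ i, (Fin.snoc (α := fun _ => SignType) X 0 : Fin (n + 1) → SignType) i ≠ 0 := by
    rintro X ⟨i, hi⟩
    exact ⟨i.castSucc, by simpa using hi⟩
  constructor
  · intro X hX
    rw [← h.1 _ (nz X hX)]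
    refine congrArg lam ?_
    ext1 j
    refine Fin.lastCases ?_ (fun j => ?_) j <;> simp
  · intro X Y hX hY hXY
    apply h.2 _ _ (nz X hX) (nz Y hY)
    intro j
    refine Fin.lastCases ?_ (fun j => ?_) j
    · simp
    · simpa using hXY j

lemma total (n : ℕ) : ∀ (lam : (Fin n → SignType) → ℤ), Good lam → ∑ p, W lam p = 1 := by
  induction n with
  | zero =>
    intro lam _
    have : ∀ p, W lam p = 1 := by
      intro p
      have : PAlt 1 (fun k => lam (chain p k)) := by
        rw [palt_iff]
        exact ⟨Fin.elim0, fun a => a.elim0, fun a => a.elim0, by simp⟩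
      simp [W, ind, this]
    simp [this]
  | succ n ih =>
    intro lam h
    rw [sum_half h, Finset.sum_comm, Fin.sum_univ_castSucc]
    simp only [sum_mid, Finset.sum_const_zero, zero_add, Fin.succAbove_last]
    rw [← ih _ (good_restrict h), ← sum_last_good,
      ← Finset.sum_filter_add_sum_filter_not _ (fun p => p.1 (Fin.last n) = Fin.last n),
      Finset.filter_filter, Finset.filter_filter, sum_last_bad, add_zero]

lemma chain_inj {n : ℕ} : Function.Injective (chain (n := n)) := by
  rintro ⟨r, s⟩ ⟨r', s'⟩ h
  have hk : ∀ k j, r j ≤ k ↔ r' j ≤ k := by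
    intro k j
    have e1 := chain_ne (r, s) k j
    have e2 := chain_ne (r', s') k j
    rw [h] at e1
    exact e1.symm.trans e2
  have hr : r = r' := by
    ext1 j
    exact le_antisymm ((hk _ j).2 le_rfl) ((hk _ j).1 le_rfl)
  subst hr
  congr 1
  ext1 j
  have := congrFun (congrFun h (r j)) j
  simp only [chain, le_refl, if_true] at this
  revert this
  cases s j <;> cases s' j <;> decide

lemma chain_surj {n : ℕ} (Z : Fin n → Fin n → SignType) (h0 : ∀ k : Fin n, ∃ i, Z k i ≠ 0)
    (h1 : ∀ (k : ℕ) (h : k + 1 < n), ∀ i,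
      Z ⟨k, by omega⟩ i ≠ 0 → Z ⟨k + 1, h⟩ i = Z ⟨k, by omega⟩ i)
    (hinj : Function.Injective Z) : ∃ p, chain p = Z := by
  have hmono : ∀ (d k : ℕ) (h : k + d < n) i, Z ⟨k, by omega⟩ i ≠ 0 →
      Z ⟨k + d, h⟩ i = Z ⟨k, by omega⟩ i := by
    intro d
    induction d with
    | zero => intro k h i _; rfl
    | succ d ih =>
      intro k h i hi
      have e := ih k (by omega) i hi
      have := h1 (k + d) (by omega) i (by rw [e]; exact hi)
      rw [← e, ← this]
      rfl
  have hm : ∀ k l : Fin n, k ≤ l → ∀ i, Z k i ≠ 0 → Z l i = Z k i := by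
    intro k l hkl i hi
    have hkl' : (k : ℕ) ≤ l := hkl
    have := hmono (l - k) k (by omega) i hi
    rw [← this]
    congr 1
    ext; simp; omega
  have hex : ∀ k : Fin n, ∃ j, Z k j ≠ 0 ∧ ∀ l < k, Z l j = 0 := by
    rintro ⟨k, hk⟩
    cases k with
    | zero =>
      obtain ⟨j, hj⟩ := h0 ⟨0, hk⟩
      exact ⟨j, hj, fun l hl => absurd hl (by simp [Fin.lt_def])⟩
    | succ k =>
      by_contra hcon
      push Not at hcon
      have : Z ⟨k, by omega⟩ = Z ⟨k + 1, hk⟩ := by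
        ext1 j
        by_cases hj : Z ⟨k + 1, hk⟩ j = 0
        · by_contra hne
          by_cases hz : Z ⟨k, by omega⟩ j = 0
          · exact hne (hz.trans hj.symm)
          · exact hne (h1 k hk j hz).symm
        · obtain ⟨l, hl, hlz⟩ := hcon j hj
          have hl' : l ≤ ⟨k, by omega⟩ := by
            simp only [Fin.lt_def, Fin.le_def] at *; omega
          rw [hm _ _ hl' j hlz, hm _ _ hl.le j hlz]
      have := hinj this
      simp at this
  choose f hf hf' using hex
  have finj : Function.Injective f := by
    intro a b hab
    by_contra hne
    rcases lt_or_gt_of_ne hne with h | h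
    · exact hf a (by rw [hab]; exact hf' b a h)
    · exact hf b (by rw [← hab]; exact hf' a b h)
  let σ : Equiv.Perm (Fin n) := Equiv.ofBijective f finj.bijective_of_finite
  have hσ : ∀ k, f k = σ k := fun k => rfl
  refine ⟨(σ.symm, fun j => decide (Z (σ.symm j) j = 1)), ?_⟩
  ext1 k
  ext1 j
  obtain ⟨l, rfl⟩ := σ.surjective j
  simp only [chain, Equiv.symm_apply_apply]
  split_ifs with h
  · rw [hm l k h _ (by rw [← hσ]; exact hf l)]
    have := hf l
    rw [hσ] at this
    revert this
    generalize Z l (σ l) = x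
    revert x
    decide
  · rw [← hσ, hf' l k (not_le.1 h)]

end KF

/-- **Ky Fan lemma:** if `λ : {−1, 0, +1}^n ∖ {0} → {±1, …, ±m}` satisfies
`λ(−X) = −λ(X)` and there is no pair `X ⊆ Y` with `λ(X) = −λ(Y)`, then the number of
alternating chains is odd; in particular such a chain exists and `m ≥ n`. -/
theorem ky_fan_lemma (m n : ℕ) (hm : 1 ≤ m) (hn : 1 ≤ n)
    (lam : (Fin n → SignType) → ℤ)
    (hrange : ∀ X : Fin n → SignType, (∃ i, X i ≠ 0) → 1 ≤ |lam X| ∧ |lam X| ≤ m)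
    (hodd : ∀ X : Fin n → SignType, (∃ i, X i ≠ 0) →
      lam (fun i => -X i) = -lam X)
    (hcomp : ∀ X Y : Fin n → SignType, (∃ i, X i ≠ 0) → (∃ i, Y i ≠ 0) →
      (∀ i, X i ≠ 0 → Y i = X i) → lam X ≠ -lam Y) :
    Odd (kyFanChains m n lam).ncard ∧ (kyFanChains m n lam).Nonempty ∧ n ≤ m := by
  classical
  have hg : KF.Good lam := ⟨hodd, hcomp⟩
  have hset : kyFanChains m n lam =
      KF.chain '' {p | KF.PAlt 1 (fun k => lam (KF.chain p k))} := by
    ext Z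
    constructor
    · rintro ⟨h0, h1, c, hc, hcb, hr⟩
      have hp : KF.PAlt 1 (fun k => lam (Z k)) :=
        (KF.palt_iff _).2 ⟨c, hc, fun k => (hcb k).1, hr⟩
      have hinj : Function.Injective Z := fun a b hab => hp.1 (by simp only [hab])
      obtain ⟨p, rfl⟩ := KF.chain_surj Z h0 h1 hinj
      exact ⟨p, hp, rfl⟩
    · rintro ⟨p, hp, rfl⟩
      obtain ⟨c, hc, hc1, hr⟩ := (KF.palt_iff _).1 hp
      refine ⟨KF.chain_nz p, ?_, c, hc, fun k => ⟨hc1 k, ?_⟩, hr⟩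
      · intro k h i hi
        exact KF.chain_le p _ _ (by simp [Fin.le_def]) i hi
      · have hk : (-1) ^ (k : ℕ) * c k ∈ Set.range (fun k => lam (KF.chain p k)) := by
          rw [hr]; exact ⟨k, rfl⟩
        obtain ⟨j, hj⟩ := hk
        have hb := (hrange _ (KF.chain_nz p j)).2
        have ha := KF.abs_term 1 (by simp) k (c k) (hc1 k)
        simp only at hj
        rw [hj] at hb
        rw [one_mul] at ha
        rw [ha] at hb
        exact hb
  have hcard : ((kyFanChains m n lam).ncard : ZMod 2) = 1 := by
    rw [hset, Set.ncard_image_of_injective _ KF.chain_inj, ← KF.total n lam hg]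
    rw [Set.ncard_eq_toFinset_card', Set.toFinset_setOf, ← Finset.sum_boole]
    apply Finset.sum_congr rfl
    intro p _
    simp only [KF.W, KF.ind]
  have hO : Odd (kyFanChains m n lam).ncard := ZMod.natCast_eq_one_iff_odd.1 hcard
  have hN : (kyFanChains m n lam).Nonempty := by
    rw [Set.nonempty_iff_ne_empty]
    intro he
    rw [he] at hO
    simp at hO
  refine ⟨hO, hN, ?_⟩
  obtain ⟨Z, _, _, c, hc, hcb, _⟩ := hN
  have := Finset.card_le_card_of_injOn (s := Finset.univ) (t := Finset.Icc (1 : ℤ) m) c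
    (fun k _ => by simpa using hcb k) (hc.injective.injOn)
  simpa using this
end
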